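/- arXiv:1703.04053 — 2 statements merged into one kernel-verified Lean document; each statement's English description precedes it below -/
import Mathlib

section
/- Let N ≥ 2, μ ≤ μ₀ = (N-2)²/4, γ ∈ (0,1), and let f ∈ C^γ_loc(ℝ^N∖{0}) satisfy ∫_K |f(x)||x|^{τ₊(μ)} dx < +∞ for every compact K ⊂ ℝ^N. Let u be a classical solution of -Δu - μ|x|^{-2}u = f in ℝ^N∖{0} with lim_{|x|→+∞} u(x) = 0 and u ≥ 0 on B_r(0)∖{0} for some r > 0. Then there exists k ≥ 0 such that ∫_{ℝ^N} u(x) L*_μξ(x) |x|^{τ₊(μ)} dx = ∫_{ℝ^N} f(x) ξ(x) |x|^{τ₊(μ)} dx + c_μ k ξ(0) for every compactly supported C^{1,1} function ξ on ℝ^N. -/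
open Filter MeasureTheory Metric

noncomputable section

/-- Euclidean space ℝ^N. -/
abbrev Euc (N : ℕ) : Type := EuclideanSpace ℝ (Fin N)

/-- The Laplacian of `u` at `x`, as the sum of the pure second derivatives in the
coordinate directions. -/
def lap {N : ℕ} (u : Euc N → ℝ) (x : Euc N) : ℝ :=
  ∑ i : Fin N, fderiv ℝ (fun y => fderiv ℝ u y (EuclideanSpace.single i 1)) x
    (EuclideanSpace.single i 1)

/-- μ₀ = (N-2)²/4. -/
def mu0 (N : ℕ) : ℝ := ((N : ℝ) - 2) ^ 2 / 4

/-- τ₋(μ) = -(N-2)/2 - √(μ₀-μ). -/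
def tauMinus (N : ℕ) (μ : ℝ) : ℝ := -((N : ℝ) - 2) / 2 - Real.sqrt (mu0 N - μ)

/-- τ₊(μ) = -(N-2)/2 + √(μ₀-μ). -/
def tauPlus (N : ℕ) (μ : ℝ) : ℝ := -((N : ℝ) - 2) / 2 + Real.sqrt (mu0 N - μ)

/-- Surface area of the unit sphere in ℝ^N, i.e. N times the volume of the unit ball. -/
def sphereArea (N : ℕ) : ℝ := N * (volume (ball (0 : Euc N) 1)).toReal

/-- The normalizing constant c_μ: 2√(μ₀-μ)|𝕊^{N-1}| for μ < μ₀ and |𝕊^{N-1}| for μ = μ₀. -/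
def cMu (N : ℕ) (μ : ℝ) : ℝ :=
  if μ < mu0 N then 2 * Real.sqrt (mu0 N - μ) * sphereArea N else sphereArea N

/-- The normalizing constant c_N = ((N-2)|𝕊^{N-1}|)⁻¹ of the fundamental solution of -Δ. -/
def cN (N : ℕ) : ℝ := (((N : ℝ) - 2) * sphereArea N)⁻¹

/-- The singular profile Φ_μ: |x|^{τ₋(μ)} for μ < μ₀ and |x|^{-(N-2)/2}(-ln|x|) for μ = μ₀. -/
def PhiFun (N : ℕ) (μ : ℝ) (x : Euc N) : ℝ :=
  if μ < mu0 N then ‖x‖ ^ tauMinus N μ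
  else ‖x‖ ^ (-((N : ℝ) - 2) / 2) * (-Real.log ‖x‖)

/-- The adjoint operator L*_μ ξ(x) = -Δξ(x) - 2τ₊(μ)|x|⁻² x·∇ξ(x). -/
def LstarMu (N : ℕ) (μ : ℝ) (ξ : Euc N → ℝ) (x : Euc N) : ℝ :=
  -lap ξ x - 2 * tauPlus N μ / ‖x‖ ^ 2 * fderiv ℝ ξ x x

/-- The adjoint operator L*_{μV} ξ = L*_μ ξ - μ(V - |x|⁻²)ξ. -/
def LstarMuV (N : ℕ) (μ : ℝ) (V ξ : Euc N → ℝ) (x : Euc N) : ℝ :=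
  LstarMu N μ ξ x - μ * (V x - ‖x‖ ^ (-2 : ℝ)) * ξ x

/-- A compactly supported C^{1,1} test function: compactly supported, differentiable,
with Lipschitz gradient. -/
def IsC11c {N : ℕ} (ξ : Euc N → ℝ) : Prop :=
  HasCompactSupport ξ ∧ Differentiable ℝ ξ ∧ ∃ L : NNReal, LipschitzWith L (fderiv ℝ ξ)

/-- The dμ-distributional identity with constant `k`. -/
def DistribIdentity (N : ℕ) (μ : ℝ) (V u : Euc N → ℝ) (k : ℝ) : Prop :=
  ∀ ξ : Euc N → ℝ, IsC11c ξ →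
    ∫ x : Euc N, u x * LstarMuV N μ V ξ x * ‖x‖ ^ tauPlus N μ = cMu N μ * k * ξ 0

/-- `u` is a classical solution of -Δu - μVu = 0 in ℝ^N∖{0}. -/
def IsSolution (N : ℕ) (μ : ℝ) (V u : Euc N → ℝ) : Prop :=
  ContDiffOn ℝ 2 u {x : Euc N | x ≠ 0} ∧
  ∀ x : Euc N, x ≠ 0 → -lap u x - μ * V x * u x = 0

/-- `f` is locally γ-Hölder continuous on `s`. -/
def LocHolderOn {N : ℕ} (γ : ℝ) (s : Set (Euc N)) (f : Euc N → ℝ) : Prop :=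
  ∀ x ∈ s, ∃ ε > 0, ∃ C > 0, ∀ y ∈ ball x ε ∩ s, ∀ z ∈ ball x ε ∩ s,
    |f y - f z| ≤ C * dist y z ^ γ

/-- The filter `‖x‖ → +∞` on ℝ^N. -/
def normAtTop (N : ℕ) : Filter (Euc N) := comap norm atTop

/-- Assumption (V): V is locally Hölder and positive on ℝ^N∖{0},
0 ≤ V(x) - |x|⁻² ≤ c₀, and limsup_{|x|→∞} V(x)|x|² = α. -/
def AssumpV (N : ℕ) (V : Euc N → ℝ) (α : ℝ) : Prop :=
  (∃ γ : ℝ, 0 < γ ∧ γ < 1 ∧ LocHolderOn γ {x : Euc N | x ≠ 0} V) ∧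
  (∀ x : Euc N, x ≠ 0 → 0 < V x) ∧
  (∃ c₀ : ℝ, 0 < c₀ ∧ ∀ x : Euc N, x ≠ 0 →
    0 ≤ V x - ‖x‖ ^ (-2 : ℝ) ∧ V x - ‖x‖ ^ (-2 : ℝ) ≤ c₀) ∧
  limsup (fun x : Euc N => V x * ‖x‖ ^ 2) (normAtTop N) = α

/-- Assumption (Ṽ): V is locally Hölder and positive on ℝ^N∖{0},
0 ≤ V(x) - |x|⁻² ≤ c₀, and liminf_{|x|→∞} V(x)|x|² = β. -/
def AssumpVtilde (N : ℕ) (V : Euc N → ℝ) (β : ℝ) : Prop :=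
  (∃ γ : ℝ, 0 < γ ∧ γ < 1 ∧ LocHolderOn γ {x : Euc N | x ≠ 0} V) ∧
  (∀ x : Euc N, x ≠ 0 → 0 < V x) ∧
  (∃ c₀ : ℝ, 0 < c₀ ∧ ∀ x : Euc N, x ≠ 0 →
    0 ≤ V x - ‖x‖ ^ (-2 : ℝ) ∧ V x - ‖x‖ ^ (-2 : ℝ) ≤ c₀) ∧
  liminf (fun x : Euc N => V x * ‖x‖ ^ 2) (normAtTop N) = β

/-- The potential V_ρ(x) = |x|⁻²(1 + ρ|x|²)/(1 + |x|²). -/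
def Vrho (N : ℕ) (ρ : ℝ) (x : Euc N) : ℝ :=
  ‖x‖ ^ (-2 : ℝ) * (1 + ρ * ‖x‖ ^ 2) / (1 + ‖x‖ ^ 2)

/-- Ω has C² boundary: it is the sublevel set of a C² function whose differential
does not vanish on the boundary. -/
def HasC2Boundary {N : ℕ} (Ω : Set (Euc N)) : Prop :=
  ∃ φ : Euc N → ℝ, ContDiff ℝ 2 φ ∧ Ω = {x | φ x < 0} ∧
    ∀ x ∈ frontier Ω, fderiv ℝ φ x ≠ 0

/-- Integration by parts on `ℝ^N` of a `C¹` function against a compactly supported Lipschitz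
function, with integrability. -/
lemma integral_mul_fderiv_add_fderiv_mul_eq_zero {N : ℕ} {W g : Euc N → ℝ} {C : NNReal}
    (hW : ContDiff ℝ 1 W) (hg : LipschitzWith C g) (hgc : HasCompactSupport g) (v : Euc N) :
    Integrable (fun x => W x * fderiv ℝ g x v + fderiv ℝ W x v * g x) ∧
      ∫ x, (W x * fderiv ℝ g x v + fderiv ℝ W x v * g x) = 0 := by
  obtain ⟨R, hR⟩ := hgc.isCompact.isBounded.subset_ball (0 : Euc N)
  have hR1 : tsupport g ⊆ ball 0 (max R 1) := hR.trans (ball_subset_ball (le_max_left _ _))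
  let b : ContDiffBump (0 : Euc N) := ⟨max R 1, max R 1 + 1, by positivity, by linarith⟩
  let W' : Euc N → ℝ := fun x => b x * W x
  have hW'c : ContDiff ℝ 1 W' := (b.contDiff (n := 1)).mul hW
  have hW's : HasCompactSupport W' := b.hasCompactSupport.mul_right
  obtain ⟨D, hD⟩ := ContDiff.lipschitzWith_of_hasCompactSupport hW's hW'c one_ne_zero
  have hone : ∀ x ∈ tsupport g, W' =ᶠ[nhds x] W := by
    intro x hx
    filter_upwards [isOpen_ball.mem_nhds (hR1 hx)] with y hy
    simp [W', b.one_of_mem_closedBall (ball_subset_closedBall hy)]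
  have hgd : ∀ᵐ x : Euc N, DifferentiableAt ℝ g x := hg.ae_differentiableAt
  have hzero : ∀ x, x ∉ tsupport g → g x = 0 ∧ fderiv ℝ g x = 0 := fun x hx =>
    ⟨image_eq_zero_of_notMem_tsupport hx, by
      by_contra h
      exact hx (support_fderiv_subset ℝ h)⟩
  have e1 : ∀ x, W' x * fderiv ℝ g x v = W x * fderiv ℝ g x v := by
    intro x
    by_cases hx : x ∈ tsupport g
    · rw [(hone x hx).eq_of_nhds]
    · simp [(hzero x hx).2]
  have e2 : ∀ x, fderiv ℝ W' x v * g x = fderiv ℝ W x v * g x := by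
    intro x
    by_cases hx : x ∈ tsupport g
    · rw [(hone x hx).fderiv_eq]
    · simp [(hzero x hx).1]
  have i1 : Integrable (fun x => W' x * fderiv ℝ g x v) := by
    have h := (hW'c.continuous.integrable_of_hasCompactSupport (μ := volume) hW's).bdd_mul
      (measurable_fderiv_apply_const ℝ g v).aestronglyMeasurable (c := C * ‖v‖)
      (.of_forall fun x => (ContinuousLinearMap.le_opNorm _ _).trans
        (mul_le_mul_of_nonneg_right (norm_fderiv_le_of_lipschitz ℝ hg) (norm_nonneg _)))
    simpa only [mul_comm] using h
  have i2 : Integrable (fun x => fderiv ℝ W' x v * g x) :=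
    (((hW'c.continuous_fderiv one_ne_zero).clm_apply continuous_const).mul
      hg.continuous).integrable_of_hasCompactSupport hgc.mul_left
  have key := LipschitzWith.integral_lineDeriv_mul_eq (μ := volume) hD hg hgc v
  have k1 : ∫ x, lineDeriv ℝ W' x v * g x = ∫ x, fderiv ℝ W' x v * g x := by
    congr 1; ext x
    rw [((hW'c.differentiable one_ne_zero) x).lineDeriv_eq_fderiv]
  have k2 : ∫ x, lineDeriv ℝ g x (-v) * W' x = - ∫ x, W' x * fderiv ℝ g x v := by
    rw [← integral_neg]
    refine integral_congr_ae ?_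
    filter_upwards [hgd] with x hx
    rw [hx.lineDeriv_eq_fderiv, map_neg]; ring
  simp only [e1, e2] at i1 i2 k1 k2
  refine ⟨i1.add i2, ?_⟩
  rw [integral_add i1 i2, ← k1, key, k2]; ring

/-- A function that is `C^n` off the origin and vanishes near the origin is `C^n`. -/
lemma contDiff_of_eventually_eq_zero {N : ℕ} {n : WithTop ℕ∞} {F : Euc N → ℝ}
    (hF : ContDiffOn ℝ n F {x : Euc N | x ≠ 0}) (h0 : F =ᶠ[nhds 0] fun _ => 0) :
    ContDiff ℝ n F := by
  rw [contDiff_iff_contDiffAt]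
  intro x
  by_cases hx : x = 0
  · subst hx
    exact contDiffAt_const.congr_of_eventuallyEq h0
  · exact hF.contDiffAt (isOpen_ne.mem_nhds hx)

/-- The directional derivative of a `C²` function off the origin is `C¹` there. -/
lemma ContDiffOn.fderiv_apply_punctured {N : ℕ} {u : Euc N → ℝ}
    (hu : ContDiffOn ℝ 2 u {x : Euc N | x ≠ 0}) (v : Euc N) :
    ContDiffOn ℝ 1 (fun x => fderiv ℝ u x v) {x : Euc N | x ≠ 0} :=
  (hu.fderiv_of_isOpen isOpen_ne (by norm_num)).clm_apply contDiffOn_const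

lemma LipschitzWith.fderiv_apply_const {N : ℕ} {ξ : Euc N → ℝ} {L : NNReal}
    (h : LipschitzWith L (fderiv ℝ ξ)) (v : Euc N) :
    LipschitzWith (‖v‖₊ * L) (fun x => fderiv ℝ ξ x v) :=
  LipschitzWith.of_dist_le_mul fun x y => by
    have h1 := (fderiv ℝ ξ x - fderiv ℝ ξ y).le_opNorm v
    have h2 := mul_le_mul_of_nonneg_right (h.dist_le_mul x y) (norm_nonneg v)
    rw [dist_eq_norm] at h2
    rw [dist_eq_norm]
    push_cast
    simp only [sub_apply] at h1
    linarith

/-- A compactly supported function with Lipschitz gradient is Lipschitz. -/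
lemma IsC11c.exists_lipschitzWith {N : ℕ} {ξ : Euc N → ℝ} (hξ : IsC11c ξ) :
    ∃ C, LipschitzWith C ξ := by
  obtain ⟨hc, hd, L, hL⟩ := hξ
  have h1 : ContDiff ℝ 1 ξ := contDiff_one_iff_fderiv.2 ⟨hd, hL.continuous⟩
  exact ContDiff.lipschitzWith_of_hasCompactSupport hc h1 one_ne_zero

/-- Green's identity for `u ∈ C²(ℝ^N∖{0})` against the product of a `C²` function vanishing near
the origin and a compactly supported `C^{1,1}` function. -/
lemma green_identity {N : ℕ} [NeZero N] {u Q ξ : Euc N → ℝ}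
    (hu : ContDiffOn ℝ 2 u {x : Euc N | x ≠ 0}) (hQ : ContDiff ℝ 2 Q)
    (hQ0 : Q =ᶠ[nhds 0] fun _ => 0) (hξ : IsC11c ξ) :
    Integrable (fun x => u x * (Q x * lap ξ x + 2 * ∑ i, fderiv ℝ Q x (EuclideanSpace.single i 1) *
        fderiv ℝ ξ x (EuclideanSpace.single i 1)) + ξ x * (u x * lap Q x - Q x * lap u x)) ∧
      ∫ x, (u x * (Q x * lap ξ x + 2 * ∑ i, fderiv ℝ Q x (EuclideanSpace.single i 1) *
        fderiv ℝ ξ x (EuclideanSpace.single i 1)) + ξ x * (u x * lap Q x - Q x * lap u x)) = 0 := by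
  obtain ⟨C, hC⟩ := hξ.exists_lipschitzWith
  obtain ⟨hc, hd, L, hL⟩ := hξ
  set e : Fin N → Euc N := fun i => EuclideanSpace.single i 1 with he
  have hQ0' : ∀ v : Euc N, (fun x => fderiv ℝ Q x v) =ᶠ[nhds 0] fun _ => 0 := fun v => by
    filter_upwards [hQ0.eventuallyEq_nhds] with x hx
    simp [hx.fderiv_eq]
  have hQ1 : ∀ v : Euc N, ContDiff ℝ 1 (fun x => fderiv ℝ Q x v) := fun v =>
    (hQ.fderiv_right (by norm_num)).clm_apply contDiff_const
  let W : Euc N → ℝ := fun x => u x * Q x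
  let V : Fin N → Euc N → ℝ := fun i x => u x * fderiv ℝ Q x (e i) - Q x * fderiv ℝ u x (e i)
  have hW : ContDiff ℝ 1 W := by
    refine contDiff_of_eventually_eq_zero
      ((hu.of_le (by norm_num)).mul (hQ.of_le (by norm_num)).contDiffOn) ?_
    filter_upwards [hQ0] with x hx
    simp [W, hx]
  have hV : ∀ i, ContDiff ℝ 1 (V i) := by
    intro i
    refine contDiff_of_eventually_eq_zero (((hu.of_le (by norm_num)).mul (hQ1 _).contDiffOn).sub
      ((hQ.of_le (by norm_num)).contDiffOn.mul (hu.fderiv_apply_punctured _))) ?_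
    filter_upwards [hQ0, hQ0' (e i)] with x hx hx'
    simp [V, hx, hx']
  have h1 := fun i => integral_mul_fderiv_add_fderiv_mul_eq_zero hW (hL.fderiv_apply_const (e i))
    (hc.fderiv_apply ℝ (e i)) (e i)
  have h2 := fun i => integral_mul_fderiv_add_fderiv_mul_eq_zero (hV i) hC hc (e i)
  have hsum : Integrable (fun x => ∑ i,
      ((W x * fderiv ℝ (fun y => fderiv ℝ ξ y (e i)) x (e i) +
          fderiv ℝ W x (e i) * fderiv ℝ ξ x (e i)) +
        (V i x * fderiv ℝ ξ x (e i) + fderiv ℝ (V i) x (e i) * ξ x))) :=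
    integrable_finsetSum _ fun i _ => (h1 i).1.add (h2 i).1
  have hae : (fun x => ∑ i,
      ((W x * fderiv ℝ (fun y => fderiv ℝ ξ y (e i)) x (e i) +
          fderiv ℝ W x (e i) * fderiv ℝ ξ x (e i)) +
        (V i x * fderiv ℝ ξ x (e i) + fderiv ℝ (V i) x (e i) * ξ x))) =ᵐ[volume]
      fun x => u x * (Q x * lap ξ x + 2 * ∑ i, fderiv ℝ Q x (e i) *
        fderiv ℝ ξ x (e i)) + ξ x * (u x * lap Q x - Q x * lap u x) := by
    filter_upwards [Measure.ae_ne volume (0 : Euc N)] with x hx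
    have du : DifferentiableAt ℝ u x :=
      (hu.contDiffAt (isOpen_ne.mem_nhds hx)).differentiableAt (by norm_num)
    have dQ : DifferentiableAt ℝ Q x := hQ.differentiable (by norm_num) x
    have dui : ∀ i, DifferentiableAt ℝ (fun y => fderiv ℝ u y (e i)) x := fun i =>
      ((hu.fderiv_apply_punctured (e i)).contDiffAt (isOpen_ne.mem_nhds hx)).differentiableAt
        (by norm_num)
    have dQi : ∀ i, DifferentiableAt ℝ (fun y => fderiv ℝ Q y (e i)) x := fun i =>
      (hQ1 (e i)).differentiable (by norm_num) x
    have fW : fderiv ℝ W x = u x • fderiv ℝ Q x + Q x • fderiv ℝ u x := fderiv_fun_mul du dQ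
    have fV : ∀ i, fderiv ℝ (V i) x =
        (u x • fderiv ℝ (fun y => fderiv ℝ Q y (e i)) x + fderiv ℝ Q x (e i) • fderiv ℝ u x) -
        (Q x • fderiv ℝ (fun y => fderiv ℝ u y (e i)) x + fderiv ℝ u x (e i) • fderiv ℝ Q x) := by
      intro i
      exact ((du.hasFDerivAt.mul (dQi i).hasFDerivAt).sub
        (dQ.hasFDerivAt.mul (dui i).hasFDerivAt)).fderiv
    simp only [lap, mul_add, mul_sub, Finset.mul_sum, ← Finset.sum_add_distrib,
      ← Finset.sum_sub_distrib]
    refine Finset.sum_congr rfl fun i _ => ?_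
    rw [fV i, fW]
    simp only [W, V, add_apply, sub_apply, smul_apply, smul_eq_mul, he]
    ring
  refine ⟨hsum.congr hae, ?_⟩
  rw [← integral_congr_ae hae]
  refine (integral_finsetSum _ fun i _ => (h1 i).1.add (h2 i).1).trans ?_
  exact Finset.sum_eq_zero fun i _ => by
    exact (integral_add (h1 i).1 (h2 i).1).trans (by rw [(h1 i).2, (h2 i).2, add_zero])

/-- The radial function `x ↦ K (log |x|²)`, extended by zero at the origin. -/
def radialLog {N : ℕ} (K : ℝ → ℝ) (x : Euc N) : ℝ :=
  if x = 0 then 0 else K (Real.log (‖x‖ ^ 2))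

lemma radialLog_of_ne {N : ℕ} (K : ℝ → ℝ) {x : Euc N} (hx : x ≠ 0) :
    radialLog K x = K (Real.log (‖x‖ ^ 2)) := if_neg hx

lemma radialLog_eventuallyEq {N : ℕ} (K : ℝ → ℝ) {x : Euc N} (hx : x ≠ 0) :
    radialLog K =ᶠ[nhds x] fun y => K (Real.log (‖y‖ ^ 2)) := by
  filter_upwards [isOpen_ne.mem_nhds hx] with y hy using radialLog_of_ne K hy

lemma hasFDerivAt_radialLog {N : ℕ} {K : ℝ → ℝ} {k : ℝ} {x : Euc N} (hx : x ≠ 0)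
    (hK : HasDerivAt K k (Real.log (‖x‖ ^ 2))) :
    HasFDerivAt (radialLog K) ((2 * k / ‖x‖ ^ 2) • innerSL ℝ x) x := by
  have hn : ‖x‖ ^ 2 ≠ 0 := by positivity
  have h1 := (hasStrictFDerivAt_norm_sq x).hasFDerivAt
  have h2 := hK.comp_hasFDerivAt x (h1.log hn)
  refine (h2.congr_of_eventuallyEq (radialLog_eventuallyEq K hx)).congr_fderiv ?_
  ext v
  simp
  ring

lemma fderiv_radialLog {N : ℕ} {K : ℝ → ℝ} {k : ℝ} {x : Euc N} (hx : x ≠ 0)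
    (hK : HasDerivAt K k (Real.log (‖x‖ ^ 2))) (i : Fin N) :
    fderiv ℝ (radialLog K) x (EuclideanSpace.single i 1) = 2 * k / ‖x‖ ^ 2 * x i := by
  rw [(hasFDerivAt_radialLog hx hK).fderiv]
  simp [EuclideanSpace.inner_single_right]

lemma lap_radialLog {N : ℕ} {K K₁ K₂ : ℝ → ℝ} (hK : ∀ s, HasDerivAt K (K₁ s) s)
    (hK₁ : ∀ s, HasDerivAt K₁ (K₂ s) s) {x : Euc N} (hx : x ≠ 0) :
    lap (radialLog K) x = (4 * K₂ (Real.log (‖x‖ ^ 2)) +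
      (2 * N - 4) * K₁ (Real.log (‖x‖ ^ 2))) / ‖x‖ ^ 2 := by
  have hn : 0 < ‖x‖ ^ 2 := by positivity
  set s := Real.log (‖x‖ ^ 2) with hs
  have key : ∀ i : Fin N, fderiv ℝ (fun y => fderiv ℝ (radialLog K) y
      (EuclideanSpace.single i 1)) x (EuclideanSpace.single i 1) =
      (4 * K₂ s - 4 * K₁ s) / (‖x‖ ^ 2) ^ 2 * (x i) ^ 2 + 2 * K₁ s / ‖x‖ ^ 2 := by
    intro i
    have e : (fun y => fderiv ℝ (radialLog K) y (EuclideanSpace.single i 1)) =ᶠ[nhds x]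
        fun y => radialLog (fun s => 2 * K₁ s * Real.exp (-s)) y * y i := by
      filter_upwards [isOpen_ne.mem_nhds hx] with y hy
      have hy' : 0 < ‖y‖ ^ 2 := by have : y ≠ 0 := hy; positivity
      rw [fderiv_radialLog hy (hK _), radialLog_of_ne _ hy, Real.exp_neg, Real.exp_log hy']
      ring
    have d : HasDerivAt (fun s => 2 * K₁ s * Real.exp (-s))
        (2 * K₂ s * Real.exp (-s) + 2 * K₁ s * (Real.exp (-s) * (-1))) s :=
      ((hK₁ s).const_mul 2).mul ((hasDerivAt_neg s).exp)
    have dp : HasFDerivAt (fun y : Euc N => y i) (EuclideanSpace.proj i : Euc N →L[ℝ] ℝ) x :=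
      (EuclideanSpace.proj i : Euc N →L[ℝ] ℝ).hasFDerivAt
    rw [e.fderiv_eq, ((hasFDerivAt_radialLog hx d).fun_mul dp).fderiv]
    simp only [add_apply, smul_apply, innerSL_apply_apply, EuclideanSpace.inner_single_right,
      smul_eq_mul, radialLog_of_ne _ hx, ← hs]
    simp only [Real.exp_neg, hs, Real.exp_log hn]
    simp
    field_simp
    ring
  have hsum : ∑ i : Fin N, (x i) ^ 2 = ‖x‖ ^ 2 := (EuclideanSpace.real_norm_sq_eq x).symm
  simp only [lap, key, Finset.sum_add_distrib, ← Finset.mul_sum, hsum]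
  simp
  field_simp
  ring

lemma contDiff_two_of_hasDerivAt {K K₁ K₂ : ℝ → ℝ} (hK : ∀ s, HasDerivAt K (K₁ s) s)
    (hK₁ : ∀ s, HasDerivAt K₁ (K₂ s) s) (hK₂ : Continuous K₂) : ContDiff ℝ 2 K := by
  have h1 : ContDiff ℝ 1 K₁ := by
    rw [contDiff_one_iff_deriv]
    exact ⟨fun s => (hK₁ s).differentiableAt, by simpa only [funext fun s => (hK₁ s).deriv]⟩
  have : (2 : WithTop ℕ∞) = 1 + 1 := by norm_num
  rw [this, contDiff_succ_iff_deriv]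
  exact ⟨fun s => (hK s).differentiableAt, by simp, by
    simpa only [funext fun s => (hK s).deriv]⟩

lemma radialLog_eventually_eq_zero {N : ℕ} {K : ℝ → ℝ} {A : ℝ} (h0 : ∀ s ≤ A, K s = 0) :
    (radialLog K : Euc N → ℝ) =ᶠ[nhds 0] fun _ => 0 := by
  have hcont : Continuous fun x : Euc N => ‖x‖ ^ 2 := by fun_prop
  have : ∀ᶠ x : Euc N in nhds 0, ‖x‖ ^ 2 < Real.exp A :=
    hcont.continuousAt.eventually_lt continuousAt_const (by simpa using Real.exp_pos A)
  filter_upwards [this] with x hx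
  by_cases h : x = 0
  · simp [radialLog, h]
  · rw [radialLog_of_ne _ h]
    refine h0 _ ?_
    rw [Real.log_le_iff_le_exp (by positivity)]
    exact hx.le

lemma contDiffOn_radialLog {N : ℕ} {K : ℝ → ℝ} {n : WithTop ℕ∞} (hK : ContDiff ℝ n K) :
    ContDiffOn ℝ n (radialLog K : Euc N → ℝ) {x : Euc N | x ≠ 0} := by
  intro x hx
  have hn : ‖x‖ ^ 2 ≠ 0 := by have : x ≠ 0 := hx; positivity
  exact ((hK.contDiffAt.comp x ((contDiff_norm_sq ℝ).contDiffAt.log hn)).congr_of_eventuallyEq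
    (radialLog_eventuallyEq K hx)).contDiffWithinAt

lemma fderiv_apply_self_eq_sum {N : ℕ} (ξ : Euc N → ℝ) (x : Euc N) :
    fderiv ℝ ξ x x = ∑ i, x i * fderiv ℝ ξ x (EuclideanSpace.single i 1) := by
  have h := congrArg (fderiv ℝ ξ x) ((EuclideanSpace.basisFun (Fin N) ℝ).sum_repr x)
  rw [map_sum] at h
  simpa using h.symm

lemma rpow_norm_eq_exp {N : ℕ} {x : Euc N} (hx : x ≠ 0) (τ : ℝ) :
    ‖x‖ ^ τ = Real.exp (τ / 2 * Real.log (‖x‖ ^ 2)) := by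
  rw [Real.rpow_def_of_pos (norm_pos_iff.2 hx), Real.log_pow]
  congr 1; push_cast; ring

/-- The part of minus the integrand of the weighted identity tested with `ξ(x) H(log |x|²)` that
involves no second derivative of `H`, where `H₁` is the derivative of `H`. -/
def testMain (N : ℕ) (μ : ℝ) (u f ξ : Euc N → ℝ) (H H₁ : ℝ → ℝ) (x : Euc N) : ℝ :=
  u x * ‖x‖ ^ tauPlus N μ * (-(H (Real.log (‖x‖ ^ 2)) * LstarMu N μ ξ x) +
      4 * H₁ (Real.log (‖x‖ ^ 2)) / ‖x‖ ^ 2 * fderiv ℝ ξ x x) +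
    f x * ξ x * ‖x‖ ^ tauPlus N μ * H (Real.log (‖x‖ ^ 2))

/-- The part of minus the integrand of the weighted identity tested with `ξ(x) H(log |x|²)` where
`L*_μ` falls on the radial factor; `H₁, H₂` are the first two derivatives of `H`. -/
def testBulk (N : ℕ) (μ : ℝ) (u ξ : Euc N → ℝ) (H₁ H₂ : ℝ → ℝ) (x : Euc N) : ℝ :=
  ξ x * (u x * ‖x‖ ^ tauPlus N μ * (4 * H₂ (Real.log (‖x‖ ^ 2)) +
      4 * Real.sqrt (mu0 N - μ) * H₁ (Real.log (‖x‖ ^ 2))) / ‖x‖ ^ 2)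

/-- The weighted identity tested with `ξ(x) H(log |x|²)`, for `H` vanishing near `-∞`. -/
lemma integral_testMain_add_testBulk {N : ℕ} [NeZero N] {μ : ℝ} (hμ : μ ≤ mu0 N) {u f ξ : Euc N → ℝ}
    (hureg : ContDiffOn ℝ 2 u {x : Euc N | x ≠ 0})
    (hueq : ∀ x : Euc N, x ≠ 0 → -lap u x - μ * ‖x‖ ^ (-2 : ℝ) * u x = f x)
    (hξ : IsC11c ξ) {H H₁ H₂ : ℝ → ℝ} (hH : ∀ s, HasDerivAt H (H₁ s) s)
    (hH₁ : ∀ s, HasDerivAt H₁ (H₂ s) s) (hH₂ : Continuous H₂) {A : ℝ} (h0 : ∀ s ≤ A, H s = 0) :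
    Integrable (fun x => testMain N μ u f ξ H H₁ x + testBulk N μ u ξ H₁ H₂ x) ∧
      ∫ x, (testMain N μ u f ξ H H₁ x + testBulk N μ u ξ H₁ H₂ x) = 0 := by
  set τ := tauPlus N μ with hτ
  set K : ℝ → ℝ := fun s => Real.exp (τ / 2 * s) * H s with hK
  set K₁ : ℝ → ℝ := fun s => Real.exp (τ / 2 * s) * (τ / 2 * H s + H₁ s) with hK₁
  set K₂ : ℝ → ℝ := fun s => Real.exp (τ / 2 * s) * (τ ^ 2 / 4 * H s + τ * H₁ s + H₂ s) with hK₂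
  have dexp : ∀ s, HasDerivAt (fun s => Real.exp (τ / 2 * s)) (Real.exp (τ / 2 * s) * (τ / 2)) s :=
    fun s => by simpa using ((hasDerivAt_id s).const_mul (τ / 2)).exp
  have dK : ∀ s, HasDerivAt K (K₁ s) s := fun s =>
    ((dexp s).mul (hH s)).congr_deriv (by simp only [hK₁]; ring)
  have dK₁ : ∀ s, HasDerivAt K₁ (K₂ s) s := fun s =>
    ((dexp s).mul (((hH s).const_mul (τ / 2)).fun_add (hH₁ s))).congr_deriv (by
      simp only [hK₂]; ring)
  have cH : Continuous H := continuous_iff_continuousAt.2 fun s => (hH s).continuousAt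
  have cH₁ : Continuous H₁ := continuous_iff_continuousAt.2 fun s => (hH₁ s).continuousAt
  have cK₂ : Continuous K₂ := by fun_prop
  have hQ0 : (radialLog K : Euc N → ℝ) =ᶠ[nhds 0] fun _ => 0 :=
    radialLog_eventually_eq_zero (A := A) fun s hs => by simp [hK, h0 s hs]
  have hQ : ContDiff ℝ 2 (radialLog K : Euc N → ℝ) := contDiff_of_eventually_eq_zero
    (contDiffOn_radialLog (contDiff_two_of_hasDerivAt dK dK₁ cK₂)) hQ0
  obtain ⟨g1, g2⟩ := green_identity hureg hQ hQ0 hξ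
  have hsq : Real.sqrt (mu0 N - μ) ^ 2 = mu0 N - μ := Real.sq_sqrt (by linarith)
  have hae : (fun x => u x * (radialLog K x * lap ξ x + 2 * ∑ i,
      fderiv ℝ (radialLog K) x (EuclideanSpace.single i 1) *
        fderiv ℝ ξ x (EuclideanSpace.single i 1)) +
      ξ x * (u x * lap (radialLog K) x - radialLog K x * lap u x)) =ᵐ[volume]
      fun x => testMain N μ u f ξ H H₁ x + testBulk N μ u ξ H₁ H₂ x := by
    filter_upwards [Measure.ae_ne volume (0 : Euc N)] with x hx
    have hn : 0 < ‖x‖ ^ 2 := by positivity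
    have hlap : lap u x = - f x - μ * u x / ‖x‖ ^ 2 := by
      have h := hueq x hx
      have e : ‖x‖ ^ (-2 : ℝ) = (‖x‖ ^ 2)⁻¹ := by
        rw [Real.rpow_neg (norm_nonneg x)]; norm_cast
      rw [e] at h
      rw [← h]; ring
    have hs : ∑ i, fderiv ℝ (radialLog K) x (EuclideanSpace.single i 1) *
        fderiv ℝ ξ x (EuclideanSpace.single i 1) =
        2 * K₁ (Real.log (‖x‖ ^ 2)) / ‖x‖ ^ 2 * fderiv ℝ ξ x x := by
      rw [fderiv_apply_self_eq_sum, Finset.mul_sum]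
      refine Finset.sum_congr rfl fun i _ => ?_
      rw [fderiv_radialLog hx (dK _)]; ring
    rw [hs, lap_radialLog dK dK₁ hx, hlap, radialLog_of_ne _ hx]
    simp only [testMain, testBulk, LstarMu, ← hτ, rpow_norm_eq_exp hx, hK, hK₁, hK₂]
    set y := Real.log (‖x‖ ^ 2)
    set E := Real.exp (τ / 2 * y)
    set S := Real.sqrt (mu0 N - μ)
    have hτS : τ = -((N : ℝ) - 2) / 2 + S := hτ
    have hμS : μ = ((N : ℝ) - 2) ^ 2 / 4 - S ^ 2 := by rw [hsq, mu0]; ring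
    rw [hμS, hτS]
    field_simp
    ring
  exact ⟨g1.congr hae, by rw [← integral_congr_ae hae]; exact g2⟩

lemma hasDerivAt_max_zero_pow (k : ℕ) (z : ℝ) :
    HasDerivAt (fun z : ℝ => max z 0 ^ (k + 2)) ((k + 2) * max z 0 ^ (k + 1)) z := by
  rcases lt_trichotomy z 0 with h | h | h
  · have e : (fun z : ℝ => max z 0 ^ (k + 2)) =ᶠ[nhds z] fun _ => 0 := by
      filter_upwards [Iio_mem_nhds h] with y hy
      simp [max_eq_right (Set.mem_Iio.1 hy).le]
    simpa [max_eq_right h.le] using (hasDerivAt_const z (0 : ℝ)).congr_of_eventuallyEq e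
  · subst h
    rw [hasDerivAt_iff_isLittleO_nhds_zero]
    have h1 : (fun h : ℝ => max (0 + h) 0 ^ (k + 2) - max 0 0 ^ (k + 2) -
        h • (((k : ℝ) + 2) * max 0 0 ^ (k + 1))) =O[nhds 0] fun h => h ^ (k + 2) := by
      refine Asymptotics.IsBigO.of_bound 1 (.of_forall fun h => ?_)
      simp only [zero_add, max_self, ne_eq, Nat.add_eq_zero_iff, OfNat.ofNat_ne_zero, and_false,
        not_false_eq_true, zero_pow, sub_zero, one_ne_zero, mul_zero, smul_zero, norm_pow, one_mul]
      gcongr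
      rw [Real.norm_eq_abs, Real.norm_eq_abs, abs_of_nonneg (le_max_right _ _)]
      exact max_le (le_abs_self h) (abs_nonneg h)
    refine h1.trans_isLittleO ?_
    simpa using Asymptotics.isLittleO_pow_pow (𝕜 := ℝ) (m := 1) (n := k + 2) (by omega)
  · have e : (fun z : ℝ => max z 0 ^ (k + 2)) =ᶠ[nhds z] fun z => z ^ (k + 2) := by
      filter_upwards [Ioi_mem_nhds h] with y hy
      simp [max_eq_left (Set.mem_Ioi.1 hy).le]
    rw [max_eq_left h.le]
    refine HasDerivAt.congr_of_eventuallyEq ?_ e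
    simpa using hasDerivAt_pow (k + 2) z

/-- The convex increasing profile `(1 + a s)₊³`, vanishing for `s ≤ -1/a`. -/
def cutoff (a s : ℝ) : ℝ := max (1 + a * s) 0 ^ 3

/-- The first derivative of `cutoff a`. -/
def cutoffDeriv (a s : ℝ) : ℝ := 3 * a * max (1 + a * s) 0 ^ 2

/-- The second derivative of `cutoff a`. -/
def cutoffDeriv₂ (a s : ℝ) : ℝ := 6 * a ^ 2 * max (1 + a * s) 0

lemma hasDerivAt_cutoff (a s : ℝ) : HasDerivAt (cutoff a) (cutoffDeriv a s) s := by
  have h : HasDerivAt (fun s => 1 + a * s) a s := by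
    simpa using ((hasDerivAt_id s).const_mul a).const_add 1
  refine ((hasDerivAt_max_zero_pow 1 (1 + a * s)).comp s h).congr_deriv ?_
  simp only [cutoffDeriv]; push_cast; ring

lemma hasDerivAt_cutoffDeriv (a s : ℝ) : HasDerivAt (cutoffDeriv a) (cutoffDeriv₂ a s) s := by
  have h : HasDerivAt (fun s => 1 + a * s) a s := by
    simpa using ((hasDerivAt_id s).const_mul a).const_add 1
  refine (((hasDerivAt_max_zero_pow 0 (1 + a * s)).comp s h).const_mul (3 * a)).congr_deriv ?_
  simp only [cutoffDeriv₂]; push_cast; ring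

lemma continuous_cutoffDeriv₂ (a : ℝ) : Continuous (cutoffDeriv₂ a) := by
  unfold cutoffDeriv₂; fun_prop

lemma cutoff_eq_zero {a s : ℝ} (ha : 0 < a) (hs : s ≤ -a⁻¹) : cutoff a s = 0 := by
  have : 1 + a * s ≤ 0 := by
    have := mul_le_mul_of_nonneg_left hs ha.le
    rw [mul_neg, mul_inv_cancel₀ ha.ne'] at this
    linarith
  simp [cutoff, max_eq_right this]

lemma cutoff_nonneg (a s : ℝ) : 0 ≤ cutoff a s := by unfold cutoff; positivity

lemma cutoffDeriv_nonneg {a : ℝ} (ha : 0 < a) (s : ℝ) : 0 ≤ cutoffDeriv a s := by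
  unfold cutoffDeriv; positivity

lemma cutoffDeriv₂_nonneg (a s : ℝ) : 0 ≤ cutoffDeriv₂ a s := by
  unfold cutoffDeriv₂; positivity

lemma cutoff_bounds {a s Y : ℝ} (ha : 0 < a) (ha1 : a ≤ 1) (hs : s ≤ Y) (hY : 0 ≤ Y) :
    cutoff a s ≤ 6 * (1 + Y) ^ 3 ∧ cutoffDeriv a s ≤ 6 * (1 + Y) ^ 3 ∧
      cutoffDeriv₂ a s ≤ 6 * (1 + Y) ^ 3 := by
  unfold cutoff cutoffDeriv cutoffDeriv₂
  have h0 : 0 ≤ max (1 + a * s) 0 := le_max_right _ _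
  have hm : max (1 + a * s) 0 ≤ 1 + Y := by
    refine max_le ?_ (by linarith)
    nlinarith
  set m := max (1 + a * s) 0
  have h1 : (1 : ℝ) ≤ 1 + Y := by linarith
  have hm2 : m ^ 2 ≤ (1 + Y) ^ 2 := by gcongr
  have hm3 : m ^ 3 ≤ (1 + Y) ^ 3 := by gcongr
  have h2 : (1 + Y) ^ 2 ≤ (1 + Y) ^ 3 := pow_le_pow_right₀ h1 (by norm_num)
  have h3 : (1 + Y) ^ 1 ≤ (1 + Y) ^ 3 := pow_le_pow_right₀ h1 (by norm_num)
  have ha2 : a ^ 2 ≤ 1 := pow_le_one₀ ha.le ha1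
  refine ⟨by nlinarith [pow_nonneg h0 3], ?_, ?_⟩
  · nlinarith [mul_le_mul_of_nonneg_right ha1 (sq_nonneg m), sq_nonneg (1 + Y)]
  · nlinarith [mul_le_mul_of_nonneg_right ha2 h0]

lemma tendsto_cutoff {a : ℕ → ℝ} (ha : Tendsto a atTop (nhds 0)) (s : ℝ) :
    Tendsto (fun n => cutoff (a n) s) atTop (nhds 1) ∧
      Tendsto (fun n => cutoffDeriv (a n) s) atTop (nhds 0) ∧
      Tendsto (fun n => cutoffDeriv₂ (a n) s) atTop (nhds 0) := by
  have h1 : Continuous fun a => cutoff a s := by unfold cutoff; fun_prop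
  have h2 : Continuous fun a => cutoffDeriv a s := by unfold cutoffDeriv; fun_prop
  have h3 : Continuous fun a => cutoffDeriv₂ a s := by unfold cutoffDeriv₂; fun_prop
  refine ⟨?_, ?_, ?_⟩
  · simpa [cutoff, Function.comp_def] using (h1.tendsto 0).comp ha
  · simpa [cutoffDeriv, Function.comp_def] using (h2.tendsto 0).comp ha
  · simpa [cutoffDeriv₂, Function.comp_def] using (h3.tendsto 0).comp ha

lemma aestronglyMeasurable_of_continuousOn_punctured {N : ℕ} [NeZero N] {g : Euc N → ℝ}
    (hg : ContinuousOn g {x : Euc N | x ≠ 0}) : AEStronglyMeasurable g volume := by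
  have h := hg.aestronglyMeasurable (μ := volume) isOpen_ne.measurableSet
  have h0 : (volume : Measure (Euc N)).restrict {x | x ≠ 0} = volume :=
    Measure.restrict_eq_self_of_ae_mem (Measure.ae_ne volume (0 : Euc N))
  rwa [h0] at h

lemma continuousOn_rpow_norm {N : ℕ} (τ : ℝ) :
    ContinuousOn (fun x : Euc N => ‖x‖ ^ τ) {x : Euc N | x ≠ 0} := fun _ hx =>
  (continuous_norm.continuousAt.rpow_const (Or.inl (norm_ne_zero_iff.2 hx))).continuousWithinAt

lemma continuousOn_lap {N : ℕ} {u : Euc N → ℝ} (hu : ContDiffOn ℝ 2 u {x : Euc N | x ≠ 0}) :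
    ContinuousOn (lap u) {x : Euc N | x ≠ 0} :=
  continuousOn_finsetSum _ fun i _ =>
    ((hu.fderiv_apply_punctured (EuclideanSpace.single i 1)).continuousOn_fderiv_of_isOpen
      isOpen_ne le_rfl).clm_apply continuousOn_const

lemma continuousOn_LstarMu {N : ℕ} {μ : ℝ} {u : Euc N → ℝ}
    (hu : ContDiffOn ℝ 2 u {x : Euc N | x ≠ 0}) :
    ContinuousOn (LstarMu N μ u) {x : Euc N | x ≠ 0} := by
  refine (continuousOn_lap hu).neg.sub ((continuousOn_const.div (by fun_prop) ?_).mul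
    ((hu.continuousOn_fderiv_of_isOpen isOpen_ne (by norm_num)).clm_apply continuousOn_id))
  intro x hx
  exact pow_ne_zero 2 (norm_ne_zero_iff.2 hx)

lemma measurable_lap {N : ℕ} (ξ : Euc N → ℝ) : Measurable (lap ξ) :=
  Finset.measurable_fun_sum _ fun _ _ => measurable_fderiv_apply_const ℝ _ _

lemma IsC11c.continuous_fderiv_apply_self {N : ℕ} {ξ : Euc N → ℝ} (hξ : IsC11c ξ) :
    Continuous fun x => fderiv ℝ ξ x x := by
  obtain ⟨-, -, L, hL⟩ := hξ
  exact hL.continuous.clm_apply continuous_id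

lemma IsC11c.measurable_LstarMu {N : ℕ} {μ : ℝ} {ξ : Euc N → ℝ} (hξ : IsC11c ξ) :
    Measurable (LstarMu N μ ξ) :=
  (measurable_lap ξ).neg.sub ((measurable_const.div (by fun_prop)).mul
    hξ.continuous_fderiv_apply_self.measurable)

lemma LstarMu_eq_zero_of_eventuallyEq_const {N : ℕ} {μ c : ℝ} {ξ : Euc N → ℝ} {x : Euc N}
    (h : ξ =ᶠ[nhds x] fun _ => c) : LstarMu N μ ξ x = 0 ∧ fderiv ℝ ξ x = 0 := by
  have h1 : fderiv ℝ ξ x = 0 := by rw [h.fderiv_eq]; simp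
  have h2 : ∀ v, (fun y => fderiv ℝ ξ y v) =ᶠ[nhds x] fun _ => (0 : ℝ) := fun v => by
    filter_upwards [h.eventuallyEq_nhds] with y hy
    rw [hy.fderiv_eq]; simp
  refine ⟨?_, h1⟩
  simp [LstarMu, lap, h1, (h2 _).fderiv_eq]

/-- Quantitative bounds on a `C^{1,1}_c` function and its image under `L*_μ`. -/
lemma IsC11c.exists_bounds {N : ℕ} (μ : ℝ) {ξ : Euc N → ℝ} (hξ : IsC11c ξ) :
    ∃ ρ C : ℝ, 1 ≤ ρ ∧ 0 ≤ C ∧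
      (∀ x : Euc N, x ≠ 0 → |LstarMu N μ ξ x| ≤ C / ‖x‖ ∧ |fderiv ℝ ξ x x| ≤ C * ‖x‖ ∧
        |ξ x - ξ 0| ≤ C * ‖x‖) ∧
      ∀ x : Euc N, ρ < ‖x‖ → ξ x = 0 ∧ fderiv ℝ ξ x x = 0 ∧ LstarMu N μ ξ x = 0 := by
  obtain ⟨D, hD⟩ := hξ.exists_lipschitzWith
  obtain ⟨hc, hd, L, hL⟩ := id hξ
  obtain ⟨R, hR⟩ := hc.isCompact.isBounded.subset_closedBall (0 : Euc N)
  have hout : ∀ x : Euc N, max R 1 < ‖x‖ →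
      ξ x = 0 ∧ fderiv ℝ ξ x x = 0 ∧ LstarMu N μ ξ x = 0 := by
    intro x hx
    have hx' : x ∉ tsupport ξ := fun h => by
      have := hR h
      rw [mem_closedBall_zero_iff] at this
      linarith [le_max_left R 1]
    have h0 : ξ =ᶠ[nhds x] fun _ => 0 := notMem_tsupport_iff_eventuallyEq.1 hx'
    have h1 := LstarMu_eq_zero_of_eventuallyEq_const (μ := μ) h0
    exact ⟨h0.eq_of_nhds, by simp [h1.2], h1.1⟩
  have hfd : ∀ x : Euc N, |fderiv ℝ ξ x x| ≤ D * ‖x‖ := fun x =>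
    ((fderiv ℝ ξ x).le_opNorm x).trans
      (mul_le_mul_of_nonneg_right (norm_fderiv_le_of_lipschitz ℝ hD) (norm_nonneg _))
  have hlap : ∀ x : Euc N, |lap ξ x| ≤ N * L := by
    intro x
    have : ∀ i ∈ Finset.univ, |fderiv ℝ (fun y => fderiv ℝ ξ y (EuclideanSpace.single i 1)) x
        (EuclideanSpace.single i 1)| ≤ (L : ℝ) := by
      intro i _
      have h1 := norm_fderiv_le_of_lipschitz ℝ (x₀ := x)
        (hL.fderiv_apply_const (EuclideanSpace.single i (1 : ℝ)))
      have h2 := (fderiv ℝ (fun y => fderiv ℝ ξ y (EuclideanSpace.single i 1)) x).le_opNorm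
        (EuclideanSpace.single i 1)
      simp at h1 h2
      exact h2.trans h1
    refine (Finset.abs_sum_le_sum_abs _ _).trans ((Finset.sum_le_sum this).trans ?_)
    simp
  have hρ : (0 : ℝ) < max R 1 := by positivity
  have hL0 : (0 : ℝ) ≤ N * L := by positivity
  refine ⟨max R 1, D + (N * L * max R 1 + 2 * |tauPlus N μ| * D), le_max_right _ _, by positivity,
    fun x hx => ⟨?_, (hfd x).trans ?_, ?_⟩, hout⟩
  · have hn : 0 < ‖x‖ := norm_pos_iff.2 hx
    by_cases hxρ : max R 1 < ‖x‖
    · rw [(hout x hxρ).2.2, abs_zero]; positivity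
    push Not at hxρ
    have h1 : |2 * tauPlus N μ / ‖x‖ ^ 2 * fderiv ℝ ξ x x| ≤ 2 * |tauPlus N μ| * D / ‖x‖ := by
      rw [abs_mul, abs_div, abs_mul, abs_two, abs_of_pos (pow_pos hn 2)]
      calc _ ≤ 2 * |tauPlus N μ| / ‖x‖ ^ 2 * (D * ‖x‖) := by gcongr; exact hfd x
        _ = _ := by field_simp
    have h2 : |lap ξ x| ≤ N * L * max R 1 / ‖x‖ := by
      rw [le_div_iff₀ hn]
      exact mul_le_mul (hlap x) hxρ hn.le hL0
    calc |LstarMu N μ ξ x| ≤ |lap ξ x| + |2 * tauPlus N μ / ‖x‖ ^ 2 * fderiv ℝ ξ x x| := by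
          rw [LstarMu, ← abs_neg (lap ξ x)]; exact abs_sub _ _
      _ ≤ D / ‖x‖ + N * L * max R 1 / ‖x‖ + 2 * |tauPlus N μ| * D / ‖x‖ := by
          have : 0 ≤ D / ‖x‖ := by positivity
          linarith
      _ ≤ _ := by
          rw [← add_div, ← add_div, add_assoc]
  · gcongr
    have : 0 ≤ N * L * max R 1 + 2 * |tauPlus N μ| * D := by positivity
    linarith
  · have h1 := hD.dist_le_mul x 0
    rw [Real.dist_eq, dist_zero_right] at h1
    refine h1.trans ?_
    gcongr
    have : 0 ≤ N * L * max R 1 + 2 * |tauPlus N μ| * D := by positivity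
    linarith

lemma isC11c_of_contDiff {N : ℕ} {χ : Euc N → ℝ} (hc : HasCompactSupport χ)
    (h : ContDiff ℝ 2 χ) : IsC11c χ :=
  ⟨hc, h.differentiable (by norm_num), ContDiff.lipschitzWith_of_hasCompactSupport
    (hc.fderiv ℝ) (h.fderiv_right (m := 1) (by norm_num)) one_ne_zero⟩

lemma IsC11c.fderiv_sub_const_mul {N : ℕ} {ξ χ : Euc N → ℝ} (hξ : IsC11c ξ) (hχ : IsC11c χ)
    (c : ℝ) : fderiv ℝ (fun x => ξ x - c * χ x) = fun x => fderiv ℝ ξ x - c • fderiv ℝ χ x := by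
  ext1 x
  exact ((hξ.2.1 x).hasFDerivAt.sub ((hχ.2.1 x).hasFDerivAt.const_mul c)).fderiv

lemma IsC11c.sub_const_mul {N : ℕ} {ξ χ : Euc N → ℝ} (hξ : IsC11c ξ) (hχ : IsC11c χ) (c : ℝ) :
    IsC11c fun x => ξ x - c * χ x := by
  have hf := hξ.fderiv_sub_const_mul hχ c
  obtain ⟨hc, hd, L, hL⟩ := hξ
  obtain ⟨hc', hd', L', hL'⟩ := hχ
  refine ⟨hc.sub hc'.mul_left, hd.sub (hd'.const_mul c), L + ‖c‖₊ * L', ?_⟩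
  rw [hf]
  exact hL.sub ((lipschitzWith_smul c).comp hL')

lemma IsC11c.LstarMu_sub_const_mul {N : ℕ} {μ : ℝ} {ξ χ : Euc N → ℝ} (hξ : IsC11c ξ)
    (hχ : IsC11c χ) (c : ℝ) : ∀ᵐ x : Euc N, LstarMu N μ (fun x => ξ x - c * χ x) x =
      LstarMu N μ ξ x - c * LstarMu N μ χ x := by
  have hf := hξ.fderiv_sub_const_mul hχ c
  obtain ⟨-, -, L, hL⟩ := hξ
  obtain ⟨-, -, L', hL'⟩ := hχ
  have h1 : ∀ᵐ x : Euc N, ∀ i : Fin N,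
      DifferentiableAt ℝ (fun y => fderiv ℝ ξ y (EuclideanSpace.single i 1)) x :=
    ae_all_iff.2 fun i => (hL.fderiv_apply_const _).ae_differentiableAt
  have h2 : ∀ᵐ x : Euc N, ∀ i : Fin N,
      DifferentiableAt ℝ (fun y => fderiv ℝ χ y (EuclideanSpace.single i 1)) x :=
    ae_all_iff.2 fun i => (hL'.fderiv_apply_const _).ae_differentiableAt
  filter_upwards [h1, h2] with x hx hx'
  have hl : lap (fun x => ξ x - c * χ x) x = lap ξ x - c * lap χ x := by
    simp only [lap, hf, Finset.mul_sum, ← Finset.sum_sub_distrib]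
    refine Finset.sum_congr rfl fun i _ => ?_
    have := ((hx i).hasFDerivAt.fun_sub ((hx' i).hasFDerivAt.const_mul c)).fderiv
    simpa using congrArg (fun T => T (EuclideanSpace.single i 1)) this
  rw [LstarMu, hl, hf]
  simp only [LstarMu, sub_apply, smul_apply, smul_eq_mul]
  ring

/-- A continuous function off the origin that vanishes near the origin and outside a ball is
integrable. -/
lemma integrable_of_eventually_eq_zero {N : ℕ} {F : Euc N → ℝ} {ρ : ℝ}
    (hF : ContinuousOn F {x : Euc N | x ≠ 0}) (h0 : F =ᶠ[nhds 0] fun _ => 0)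
    (hρ : ∀ x, ρ < ‖x‖ → F x = 0) : Integrable F := by
  have hc : Continuous F := (contDiff_of_eventually_eq_zero
    (contDiffOn_zero.2 hF) h0).continuous
  refine hc.integrable_of_hasCompactSupport
    (HasCompactSupport.intro (isCompact_closedBall (0 : Euc N) ρ) fun x hx => hρ x ?_)
  simpa using hx

/-- A majorant for `testMain` when `H` and `H₁` are bounded by `1`. -/
def testMajorant (N : ℕ) (μ : ℝ) (u f χ : Euc N → ℝ) (x : Euc N) : ℝ :=
  |u x * ‖x‖ ^ tauPlus N μ * LstarMu N μ χ x| +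
    4 * |u x * ‖x‖ ^ tauPlus N μ / ‖x‖ ^ 2 * fderiv ℝ χ x x| +
    |f x * χ x * ‖x‖ ^ tauPlus N μ|

lemma integrable_testMajorant {N : ℕ} {μ : ℝ} {u f χ : Euc N → ℝ}
    (hureg : ContDiffOn ℝ 2 u {x : Euc N | x ≠ 0}) (hχ : IsC11c χ) (hχ2 : ContDiff ℝ 2 χ)
    (hχ1 : χ =ᶠ[nhds 0] fun _ => 1) (hf : Integrable fun x => f x * χ x * ‖x‖ ^ tauPlus N μ) :
    Integrable (testMajorant N μ u f χ) := by
  obtain ⟨ρ, C, -, -, -, hout⟩ := hχ.exists_bounds μ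
  have hw : ContinuousOn (fun x => u x * ‖x‖ ^ tauPlus N μ) {x : Euc N | x ≠ 0} :=
    hureg.continuousOn.mul (continuousOn_rpow_norm _)
  have h0 : ∀ᶠ x in nhds (0 : Euc N), LstarMu N μ χ x = 0 ∧ fderiv ℝ χ x = 0 := by
    filter_upwards [hχ1.eventuallyEq_nhds] with x hx
    exact LstarMu_eq_zero_of_eventuallyEq_const hx
  refine (Integrable.add (Integrable.abs ?_) ((Integrable.abs ?_).const_mul 4)).add hf.abs
  · refine integrable_of_eventually_eq_zero (ρ := ρ)
      (hw.mul (continuousOn_LstarMu hχ2.contDiffOn)) ?_ fun x hx => by simp [(hout x hx).2.2]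
    filter_upwards [h0] with x hx
    simp [hx.1]
  · refine integrable_of_eventually_eq_zero (ρ := ρ) ((hw.div (by fun_prop) ?_).mul
      hχ.continuous_fderiv_apply_self.continuousOn) ?_ fun x hx => by simp [(hout x hx).2.1]
    · intro x hx
      exact pow_ne_zero 2 (norm_ne_zero_iff.2 hx)
    · filter_upwards [h0] with x hx
      simp [hx.2]

lemma abs_testMain_le {N : ℕ} {μ M : ℝ} {u f χ : Euc N → ℝ} {H H₁ : ℝ → ℝ} {x : Euc N}
    (h : ‖x‖ ≤ 1 → |H (Real.log (‖x‖ ^ 2))| ≤ M ∧ |H₁ (Real.log (‖x‖ ^ 2))| ≤ M)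
    (hout : 1 < ‖x‖ → χ x = 0 ∧ fderiv ℝ χ x x = 0 ∧ LstarMu N μ χ x = 0) :
    |testMain N μ u f χ H H₁ x| ≤ M * testMajorant N μ u f χ x := by
  by_cases hx : 1 < ‖x‖
  · obtain ⟨h1, h2, h3⟩ := hout hx
    simp [testMain, testMajorant, h1, h2, h3]
  obtain ⟨h1, h2⟩ := h (not_lt.1 hx)
  rw [testMain, testMajorant]
  set y := Real.log (‖x‖ ^ 2)
  set p := u x * ‖x‖ ^ tauPlus N μ * LstarMu N μ χ x with hp
  set q := u x * ‖x‖ ^ tauPlus N μ / ‖x‖ ^ 2 * fderiv ℝ χ x x with hq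
  set s := f x * χ x * ‖x‖ ^ tauPlus N μ
  have e : u x * ‖x‖ ^ tauPlus N μ * (-(H y * LstarMu N μ χ x) +
      4 * H₁ y / ‖x‖ ^ 2 * fderiv ℝ χ x x) + s * H y = -(H y * p) + 4 * (H₁ y * q) + H y * s := by
    rw [hp, hq]; ring
  rw [e]
  have a1 : |H y * p| ≤ M * |p| := by rw [abs_mul]; gcongr
  have a2 : |H₁ y * q| ≤ M * |q| := by rw [abs_mul]; gcongr
  have a3 : |H y * s| ≤ M * |s| := by rw [abs_mul]; gcongr
  rw [abs_le] at *
  constructor <;> linarith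

lemma measurable_comp_log_norm_sq {N : ℕ} {H : ℝ → ℝ} (hH : Continuous H) :
    Measurable fun x : Euc N => H (Real.log (‖x‖ ^ 2)) :=
  hH.measurable.comp (Real.measurable_log.comp (by fun_prop))

lemma aestronglyMeasurable_testMain {N : ℕ} {μ : ℝ} {u f ξ : Euc N → ℝ} {H H₁ : ℝ → ℝ}
    (hu : AEStronglyMeasurable u volume) (hf : AEStronglyMeasurable f volume) (hξ : IsC11c ξ)
    (hH : Continuous H) (hH₁ : Continuous H₁) :
    AEStronglyMeasurable (testMain N μ u f ξ H H₁) volume := by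
  have hP : Measurable fun x : Euc N => ‖x‖ ^ tauPlus N μ := by fun_prop
  have m1 := measurable_comp_log_norm_sq (N := N) hH
  have m2 := measurable_comp_log_norm_sq (N := N) hH₁
  have m3 := hξ.measurable_LstarMu (μ := μ)
  have m4 := hξ.continuous_fderiv_apply_self.measurable
  have m5 : Measurable fun x : Euc N => ‖x‖ ^ 2 := by fun_prop
  exact ((hu.mul hP.aestronglyMeasurable).mul
    ((m1.mul m3).neg.add (((m2.const_mul 4).div m5).mul m4)).aestronglyMeasurable).add
    (((hf.mul hξ.2.1.continuous.aestronglyMeasurable).mul hP.aestronglyMeasurable).mul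
      m1.aestronglyMeasurable)

lemma aestronglyMeasurable_testBulk {N : ℕ} {μ : ℝ} {u ξ : Euc N → ℝ} {H₁ H₂ : ℝ → ℝ}
    (hu : AEStronglyMeasurable u volume) (hξ : IsC11c ξ)
    (hH₁ : Continuous H₁) (hH₂ : Continuous H₂) :
    AEStronglyMeasurable (testBulk N μ u ξ H₁ H₂) volume := by
  have hP : Measurable fun x : Euc N => ‖x‖ ^ tauPlus N μ := by fun_prop
  have m1 := measurable_comp_log_norm_sq (N := N) hH₁
  have m2 := measurable_comp_log_norm_sq (N := N) hH₂
  have m5 : Measurable fun x : Euc N => (‖x‖ ^ 2)⁻¹ := by fun_prop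
  exact hξ.2.1.continuous.aestronglyMeasurable.mul (((hu.mul hP.aestronglyMeasurable).mul
    ((m2.const_mul 4).add (m1.const_mul _)).aestronglyMeasurable).mul m5.aestronglyMeasurable)

lemma continuous_cutoff (a : ℝ) : Continuous (cutoff a) := by unfold cutoff; fun_prop

lemma continuous_cutoffDeriv (a : ℝ) : Continuous (cutoffDeriv a) := by
  unfold cutoffDeriv; fun_prop

lemma lintegral_mul_cutoff_le {N : ℕ} [NeZero N] {μ : ℝ} (hμ : μ ≤ mu0 N)
    {u f χ : Euc N → ℝ} (hureg : ContDiffOn ℝ 2 u {x : Euc N | x ≠ 0})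
    (hueq : ∀ x : Euc N, x ≠ 0 → -lap u x - μ * ‖x‖ ^ (-2 : ℝ) * u x = f x)
    (hfm : AEStronglyMeasurable f volume)
    (hχ : IsC11c χ) (hχ2 : ContDiff ℝ 2 χ) (hχ1 : χ =ᶠ[nhds 0] fun _ => 1)
    (hχu : ∀ x, x ≠ 0 → 0 ≤ χ x * u x)
    (hout : ∀ x, 1 < ‖x‖ → χ x = 0 ∧ fderiv ℝ χ x x = 0 ∧ LstarMu N μ χ x = 0)
    (hf : Integrable fun x => f x * χ x * ‖x‖ ^ tauPlus N μ) {a : ℝ} (ha : 0 < a) (ha1 : a ≤ 1) :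
    ∫⁻ x, ENNReal.ofReal (χ x * (u x * ‖x‖ ^ tauPlus N μ / ‖x‖) * cutoff a (Real.log (‖x‖ ^ 2))) ≤
      ENNReal.ofReal (18 * ∫ x, testMajorant N μ u f χ x) := by
  have hD := integrable_testMajorant hureg hχ hχ2 hχ1 hf
  have hum : AEStronglyMeasurable u volume :=
    aestronglyMeasurable_of_continuousOn_punctured hureg.continuousOn
  have hg0 : ∀ᵐ x, 0 ≤ χ x * (u x * ‖x‖ ^ tauPlus N μ / ‖x‖) := by
    filter_upwards [Measure.ae_ne volume (0 : Euc N)] with x hx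
    rw [mul_div_assoc, ← mul_assoc]
    exact mul_nonneg (hχu x hx) (by positivity)
  set H : ℝ → ℝ := fun s => Real.exp (1 / 2 * s) * cutoff a s with hH
  set H₁ : ℝ → ℝ := fun s => Real.exp (1 / 2 * s) * (1 / 2 * cutoff a s + cutoffDeriv a s)
    with hH₁
  set H₂ : ℝ → ℝ := fun s => Real.exp (1 / 2 * s) *
    (1 / 4 * cutoff a s + cutoffDeriv a s + cutoffDeriv₂ a s) with hH₂
  have dexp : ∀ s, HasDerivAt (fun s : ℝ => Real.exp (1 / 2 * s))
      (Real.exp (1 / 2 * s) * (1 / 2)) s :=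
    fun s => by simpa using ((hasDerivAt_id s).const_mul (1 / 2 : ℝ)).exp
  have dH : ∀ s, HasDerivAt H (H₁ s) s := fun s =>
    ((dexp s).mul (hasDerivAt_cutoff a s)).congr_deriv (by simp only [hH₁]; ring)
  have dH₁ : ∀ s, HasDerivAt H₁ (H₂ s) s := fun s =>
    ((dexp s).mul (((hasDerivAt_cutoff a s).const_mul (1 / 2)).fun_add
      (hasDerivAt_cutoffDeriv a s))).congr_deriv (by simp only [hH₂]; ring)
  have c0 := continuous_cutoff a
  have c1 := continuous_cutoffDeriv a
  have c2 := continuous_cutoffDeriv₂ a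
  have cH : Continuous H := by fun_prop
  have cH₁ : Continuous H₁ := by fun_prop
  have cH₂ : Continuous H₂ := by fun_prop
  obtain ⟨j1, j2⟩ := integral_testMain_add_testBulk hμ hureg hueq hχ dH dH₁ cH₂
    (A := -a⁻¹) fun s hs => by simp [hH, cutoff_eq_zero ha hs]
  have hA : ∀ x : Euc N, |testMain N μ u f χ H H₁ x| ≤ 18 * testMajorant N μ u f χ x := by
    intro x
    refine abs_testMain_le (fun hx => ?_) (hout x)
    have hy : Real.log (‖x‖ ^ 2) ≤ 0 :=
      Real.log_nonpos (by positivity) (pow_le_one₀ (norm_nonneg x) hx)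
    set y := Real.log (‖x‖ ^ 2)
    obtain ⟨b1, b2, -⟩ := cutoff_bounds ha ha1 hy le_rfl
    have e0 := Real.exp_pos (1 / 2 * y)
    have e1 : Real.exp (1 / 2 * y) ≤ 1 := Real.exp_le_one_iff.2 (by linarith)
    have p1 := cutoff_nonneg a y
    have p2 := cutoffDeriv_nonneg ha y
    norm_num at b1 b2
    simp only [hH, hH₁]
    rw [abs_of_nonneg (by positivity), abs_of_nonneg (by positivity)]
    constructor <;> nlinarith
  have iA : Integrable (testMain N μ u f χ H H₁) :=
    (hD.const_mul 18).mono' (aestronglyMeasurable_testMain hum hfm hχ cH cH₁)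
      (.of_forall hA)
  have iB : Integrable (testBulk N μ u χ H₁ H₂) := by
    refine (j1.sub iA).congr (.of_forall fun x => ?_)
    simp
  have hB : ∫ x, testBulk N μ u χ H₁ H₂ x ≤ 18 * ∫ x, testMajorant N μ u f χ x := by
    rw [integral_add iA iB] at j2
    have h1 : |∫ x, testMain N μ u f χ H H₁ x| ≤ ∫ x, 18 * testMajorant N μ u f χ x :=
      norm_integral_le_of_norm_le (f := testMain N μ u f χ H H₁) (hD.const_mul 18) (.of_forall hA)
    rw [integral_const_mul] at h1
    linarith [(abs_le.1 h1).1]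
  have hle : ∀ᵐ x, (χ x * (u x * ‖x‖ ^ tauPlus N μ / ‖x‖)) * cutoff a (Real.log (‖x‖ ^ 2)) ≤
      testBulk N μ u χ H₁ H₂ x := by
    filter_upwards [Measure.ae_ne volume (0 : Euc N)] with x hx
    have hn : 0 < ‖x‖ := norm_pos_iff.2 hx
    have he : Real.exp (1 / 2 * Real.log (‖x‖ ^ 2)) = ‖x‖ := by
      rw [← rpow_norm_eq_exp hx 1, Real.rpow_one]
    simp only [testBulk, hH₁, hH₂, he]
    set y := Real.log (‖x‖ ^ 2)
    have p1 := cutoff_nonneg a y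
    have p2 := cutoffDeriv_nonneg ha y
    have p3 := cutoffDeriv₂_nonneg a y
    rw [← sub_nonneg]
    have e : χ x * (u x * ‖x‖ ^ tauPlus N μ *
        (4 * (‖x‖ * (1 / 4 * cutoff a y + cutoffDeriv a y + cutoffDeriv₂ a y)) +
        4 * √(mu0 N - μ) * (‖x‖ * (1 / 2 * cutoff a y + cutoffDeriv a y))) / ‖x‖ ^ 2) -
        χ x * (u x * ‖x‖ ^ tauPlus N μ / ‖x‖) * cutoff a y = χ x * u x *
        (‖x‖ ^ tauPlus N μ / ‖x‖ * (4 * (cutoffDeriv a y + cutoffDeriv₂ a y) +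
          4 * √(mu0 N - μ) * (1 / 2 * cutoff a y + cutoffDeriv a y))) := by
      field_simp
      ring
    rw [e]
    exact mul_nonneg (hχu x hx) (by positivity)
  have hB0 : 0 ≤ᵐ[volume] testBulk N μ u χ H₁ H₂ := by
    filter_upwards [hle, hg0] with x h1 h2
    exact (mul_nonneg h2 (cutoff_nonneg _ _)).trans h1
  calc _ ≤ ∫⁻ x, ENNReal.ofReal (testBulk N μ u χ H₁ H₂ x) :=
        lintegral_mono_ae (hle.mono fun x hx => ENNReal.ofReal_le_ofReal hx)
    _ = ENNReal.ofReal (∫ x, testBulk N μ u χ H₁ H₂ x) :=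
        (ofReal_integral_eq_lintegral_ofReal iB hB0).symm
    _ ≤ _ := ENNReal.ofReal_le_ofReal hB
/-- A consequence of Fatou's lemma. -/
lemma lintegral_le_of_tendsto {X : Type*} [MeasurableSpace X] {ν : Measure X}
    {F : ℕ → X → ENNReal} {G : X → ENNReal} {B : ENNReal} (hF : ∀ n, AEMeasurable (F n) ν)
    (hlim : ∀ x, Tendsto (fun n => F n x) atTop (nhds (G x))) (hB : ∀ n, ∫⁻ x, F n x ∂ν ≤ B) :
    ∫⁻ x, G x ∂ν ≤ B :=
  calc ∫⁻ x, G x ∂ν = ∫⁻ x, liminf (fun n => F n x) atTop ∂ν := by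
        simp only [fun x => (hlim x).liminf_eq]
    _ ≤ liminf (fun n => ∫⁻ x, F n x ∂ν) atTop := lintegral_liminf_le' hF
    _ ≤ liminf (fun _ : ℕ => B) atTop := liminf_le_liminf (.of_forall hB)
    _ = B := liminf_const _

/-- The basic integrability estimate: `u |x|^{τ₊-1}` is integrable near the origin. -/
lemma integrable_mul_weight_div_norm {N : ℕ} [NeZero N] {μ : ℝ} (hμ : μ ≤ mu0 N)
    {u f χ : Euc N → ℝ} (hureg : ContDiffOn ℝ 2 u {x : Euc N | x ≠ 0})
    (hueq : ∀ x : Euc N, x ≠ 0 → -lap u x - μ * ‖x‖ ^ (-2 : ℝ) * u x = f x)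
    (hfm : AEStronglyMeasurable f volume)
    (hχ : IsC11c χ) (hχ2 : ContDiff ℝ 2 χ) (hχ1 : χ =ᶠ[nhds 0] fun _ => 1)
    (hχu : ∀ x, x ≠ 0 → 0 ≤ χ x * u x)
    (hout : ∀ x, 1 < ‖x‖ → χ x = 0 ∧ fderiv ℝ χ x x = 0 ∧ LstarMu N μ χ x = 0)
    (hf : Integrable fun x => f x * χ x * ‖x‖ ^ tauPlus N μ) :
    Integrable fun x => χ x * (u x * ‖x‖ ^ tauPlus N μ / ‖x‖) := by
  have hum : AEStronglyMeasurable u volume :=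
    aestronglyMeasurable_of_continuousOn_punctured hureg.continuousOn
  have hPm : Measurable fun x : Euc N => ‖x‖ ^ tauPlus N μ := by fun_prop
  have hnm : Measurable fun x : Euc N => ‖x‖⁻¹ := by fun_prop
  set g : Euc N → ℝ := fun x => χ x * (u x * ‖x‖ ^ tauPlus N μ / ‖x‖) with hg
  have hgm : AEStronglyMeasurable g volume :=
    hχ.2.1.continuous.aestronglyMeasurable.mul
      ((hum.mul hPm.aestronglyMeasurable).mul hnm.aestronglyMeasurable)
  have hg0 : ∀ᵐ x, 0 ≤ g x := by
    filter_upwards [Measure.ae_ne volume (0 : Euc N)] with x hx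
    have h1 : g x = χ x * u x * (‖x‖ ^ tauPlus N μ / ‖x‖) := by simp only [hg]; ring
    rw [h1]
    exact mul_nonneg (hχu x hx) (by positivity)
  have hb : ∀ n : ℕ, ∫⁻ x, ENNReal.ofReal
      (g x * cutoff (1 / ((n : ℝ) + 1)) (Real.log (‖x‖ ^ 2))) ≤
        ENNReal.ofReal (18 * ∫ x, testMajorant N μ u f χ x) := fun n =>
    lintegral_mul_cutoff_le hμ hureg hueq hfm hχ hχ2 hχ1 hχu hout hf (by positivity)
      (by rw [div_le_one (by positivity)]; linarith [n.cast_nonneg (α := ℝ)])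
  refine ⟨hgm, ?_⟩
  rw [hasFiniteIntegral_iff_ofReal hg0]
  clear_value g
  refine lt_of_le_of_lt (lintegral_le_of_tendsto (fun n => ?_) (fun x => ?_) hb)
    ENNReal.ofReal_lt_top
  · exact (hgm.mul (measurable_comp_log_norm_sq
      (continuous_cutoff _)).aestronglyMeasurable).aemeasurable.ennreal_ofReal
  · refine ENNReal.tendsto_ofReal ?_
    have ha : Tendsto (fun n : ℕ => 1 / ((n : ℝ) + 1)) atTop (nhds 0) :=
      tendsto_one_div_add_atTop_nhds_zero_nat
    simpa only [mul_one] using (tendsto_cutoff ha (Real.log (‖x‖ ^ 2))).1.const_mul (g x)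

lemma integrableOn_mul_weight_div_norm {N : ℕ} {μ : ℝ} {u χ : Euc N → ℝ}
    (hureg : ContDiffOn ℝ 2 u {x : Euc N | x ≠ 0}) (hχ1 : χ =ᶠ[nhds 0] fun _ => 1)
    (h : Integrable fun x => χ x * (u x * ‖x‖ ^ tauPlus N μ / ‖x‖)) (ρ : ℝ) :
    IntegrableOn (fun x => u x * ‖x‖ ^ tauPlus N μ / ‖x‖) (closedBall (0 : Euc N) ρ) := by
  obtain ⟨δ, hδ, hball⟩ := Metric.eventually_nhds_iff_ball.1 hχ1
  have h1 : IntegrableOn (fun x => u x * ‖x‖ ^ tauPlus N μ / ‖x‖) (ball (0 : Euc N) δ) :=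
    h.integrableOn.congr_fun (fun x hx => by simp [hball x hx]) measurableSet_ball
  have h2 : IntegrableOn (fun x => u x * ‖x‖ ^ tauPlus N μ / ‖x‖)
      (closedBall (0 : Euc N) ρ \ ball 0 δ) := by
    refine ContinuousOn.integrableOn_compact ((isCompact_closedBall _ _).diff isOpen_ball) ?_
    refine ((hureg.continuousOn.mul (continuousOn_rpow_norm _)).div (by fun_prop)
      fun x hx => norm_ne_zero_iff.2 hx).mono ?_
    rintro x hx rfl
    exact hx.2 (mem_ball_self hδ)
  exact (h1.union h2).mono_set fun x hx => by
    by_cases hb : x ∈ ball (0 : Euc N) δ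
    · exact Or.inl hb
    · exact Or.inr ⟨hx, hb⟩

lemma integrable_mul_LstarMu {N : ℕ} [NeZero N] {μ : ℝ} {u ξ : Euc N → ℝ}
    (hum : AEStronglyMeasurable u volume)
    (hw : ∀ ρ, IntegrableOn (fun x => u x * ‖x‖ ^ tauPlus N μ / ‖x‖) (closedBall (0 : Euc N) ρ))
    (hξ : IsC11c ξ) : Integrable fun x => u x * LstarMu N μ ξ x * ‖x‖ ^ tauPlus N μ := by
  obtain ⟨ρ, C, -, hC, hin, hout⟩ := hξ.exists_bounds μ
  have hP : Measurable fun x : Euc N => ‖x‖ ^ tauPlus N μ := by fun_prop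
  refine (((hw ρ).integrable_indicator measurableSet_closedBall).abs.const_mul C).mono'
    ((hum.mul hξ.measurable_LstarMu.aestronglyMeasurable).mul hP.aestronglyMeasurable) ?_
  filter_upwards [Measure.ae_ne volume (0 : Euc N)] with x hx
  rw [Real.norm_eq_abs]
  by_cases h : ρ < ‖x‖
  · rw [(hout x h).2.2]
    simp only [mul_zero, zero_mul, abs_zero]
    positivity
  · rw [Set.indicator_of_mem (by simpa using h), mul_right_comm, abs_mul, abs_div, abs_norm]
    calc _ ≤ |u x * ‖x‖ ^ tauPlus N μ| * (C / ‖x‖) := by gcongr; exact (hin x hx).1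
      _ = _ := by ring

lemma integrable_mul_test {N : ℕ} {τ : ℝ} {f ξ : Euc N → ℝ}
    (hf : ∀ ρ, IntegrableOn (fun x => f x * ‖x‖ ^ τ) (closedBall (0 : Euc N) ρ))
    (hξ : IsC11c ξ) : Integrable fun x => f x * ξ x * ‖x‖ ^ τ := by
  have hc : Continuous ξ := hξ.2.1.continuous
  obtain ⟨R, hR⟩ := hξ.1.isCompact.isBounded.subset_closedBall (0 : Euc N)
  have h := ((hf R).continuousOn_mul hc.continuousOn (isCompact_closedBall _ _)
    ).integrable_indicator measurableSet_closedBall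
  refine h.congr (.of_forall fun x => ?_)
  by_cases hx : x ∈ closedBall (0 : Euc N) R
  · simp only [Set.indicator_of_mem hx]; ring
  · have : ξ x = 0 := image_eq_zero_of_notMem_tsupport fun h' => hx (hR h')
    simp [Set.indicator_of_notMem hx, this]

lemma tendsto_testMain_cutoff {N : ℕ} {μ : ℝ} {u f ξ : Euc N → ℝ} {a : ℕ → ℝ}
    (ha : Tendsto a atTop (nhds 0)) (x : Euc N) :
    Tendsto (fun n => testMain N μ u f ξ (cutoff (a n)) (cutoffDeriv (a n)) x) atTop
      (nhds (f x * ξ x * ‖x‖ ^ tauPlus N μ - u x * LstarMu N μ ξ x * ‖x‖ ^ tauPlus N μ)) := by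
  obtain ⟨t0, t1, -⟩ := tendsto_cutoff ha (Real.log (‖x‖ ^ 2))
  have h := (((t0.mul_const (LstarMu N μ ξ x)).neg.add
    (((t1.const_mul 4).div_const (‖x‖ ^ 2)).mul_const (fderiv ℝ ξ x x))).const_mul
      (u x * ‖x‖ ^ tauPlus N μ)).add (t0.const_mul (f x * ξ x * ‖x‖ ^ tauPlus N μ))
  unfold testMain
  convert h using 2
  ring

lemma tendsto_testBulk_cutoff {N : ℕ} {μ : ℝ} {u ξ : Euc N → ℝ} {a : ℕ → ℝ}
    (ha : Tendsto a atTop (nhds 0)) (x : Euc N) :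
    Tendsto (fun n => testBulk N μ u ξ (cutoffDeriv (a n)) (cutoffDeriv₂ (a n)) x) atTop
      (nhds 0) := by
  obtain ⟨-, t1, t2⟩ := tendsto_cutoff ha (Real.log (‖x‖ ^ 2))
  have h := ((((t2.const_mul 4).add (t1.const_mul (4 * √(mu0 N - μ)))).const_mul
    (u x * ‖x‖ ^ tauPlus N μ)).div_const (‖x‖ ^ 2)).const_mul (ξ x)
  unfold testBulk
  simpa only [mul_zero, add_zero, zero_div] using h

lemma abs_testMain_add_testBulk_le {N : ℕ} {μ M C ρ : ℝ} {u f ζ : Euc N → ℝ} {H H₁ H₂ : ℝ → ℝ}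
    {x : Euc N} (hx : x ≠ 0) (hρ : ‖x‖ ≤ ρ) (hC : 0 ≤ C)
    (h0 : |H (Real.log (‖x‖ ^ 2))| ≤ M) (h1 : |H₁ (Real.log (‖x‖ ^ 2))| ≤ M)
    (h2 : |H₂ (Real.log (‖x‖ ^ 2))| ≤ M) (hL : |LstarMu N μ ζ x| ≤ C / ‖x‖)
    (hd : |fderiv ℝ ζ x x| ≤ C * ‖x‖) (hζ : |ζ x| ≤ C * ‖x‖) :
    |testMain N μ u f ζ H H₁ x + testBulk N μ u ζ H₁ H₂ x| ≤
      M * C * (9 + 4 * √(mu0 N - μ)) * |u x * ‖x‖ ^ tauPlus N μ / ‖x‖| +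
        M * C * ρ * |f x * ‖x‖ ^ tauPlus N μ| := by
  have hn : 0 < ‖x‖ := norm_pos_iff.2 hx
  have hM : 0 ≤ M := (abs_nonneg _).trans h0
  rw [testMain, testBulk]
  set y := Real.log (‖x‖ ^ 2)
  set S := √(mu0 N - μ)
  have hS0 : 0 ≤ S := Real.sqrt_nonneg _
  set w := u x * ‖x‖ ^ tauPlus N μ
  set q := f x * ‖x‖ ^ tauPlus N μ with hq
  have e : w * (-(H y * LstarMu N μ ζ x) + 4 * H₁ y / ‖x‖ ^ 2 * fderiv ℝ ζ x x) +
      f x * ζ x * ‖x‖ ^ tauPlus N μ * H y +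
      ζ x * (w * (4 * H₂ y + 4 * S * H₁ y) / ‖x‖ ^ 2) =
      -(H y * (LstarMu N μ ζ x * ‖x‖) * (w / ‖x‖)) +
      4 * (H₁ y * (fderiv ℝ ζ x x / ‖x‖) * (w / ‖x‖)) + H y * ζ x * q +
      4 * (H₂ y * (ζ x / ‖x‖) * (w / ‖x‖)) + 4 * S * (H₁ y * (ζ x / ‖x‖) * (w / ‖x‖)) := by
    rw [hq]
    field_simp
    ring
  rw [e]
  have k0 : |LstarMu N μ ζ x * ‖x‖| ≤ C := by
    rw [abs_mul, abs_norm]; exact (le_div_iff₀ hn).1 hL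
  have k1 : |fderiv ℝ ζ x x / ‖x‖| ≤ C := by
    rw [abs_div, abs_norm]; exact (div_le_iff₀ hn).2 hd
  have k2 : |ζ x / ‖x‖| ≤ C := by
    rw [abs_div, abs_norm]; exact (div_le_iff₀ hn).2 hζ
  have k3 : |ζ x| ≤ C * ρ := hζ.trans (by gcongr)
  have aux : ∀ {a b c B : ℝ}, |a| ≤ M → |b| ≤ B → |a * b * c| ≤ M * B * |c| :=
    fun ha hb => by rw [abs_mul, abs_mul]; gcongr
  have j1 := abs_le.1 (aux (c := w / ‖x‖) h0 k0)
  have j2 := abs_le.1 (aux (c := w / ‖x‖) h1 k1)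
  have j3 := abs_le.1 (aux (c := q) h0 k3)
  have j4 := abs_le.1 (aux (c := w / ‖x‖) h2 k2)
  have j5 := aux (c := w / ‖x‖) h1 k2
  have j6 : |S * (H₁ y * (ζ x / ‖x‖) * (w / ‖x‖))| ≤ S * (M * C * |w / ‖x‖|) := by
    rw [abs_mul, abs_of_nonneg hS0]; gcongr
  rw [abs_le] at j6 ⊢
  constructor <;> linarith

lemma integral_mul_LstarMu_eq_of_apply_zero {N : ℕ} [NeZero N] {μ : ℝ} (hμ : μ ≤ mu0 N)
    {u f ζ : Euc N → ℝ} (hureg : ContDiffOn ℝ 2 u {x : Euc N | x ≠ 0})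
    (hueq : ∀ x : Euc N, x ≠ 0 → -lap u x - μ * ‖x‖ ^ (-2 : ℝ) * u x = f x)
    (hfm : AEStronglyMeasurable f volume)
    (hw : ∀ ρ, IntegrableOn (fun x => u x * ‖x‖ ^ tauPlus N μ / ‖x‖) (closedBall (0 : Euc N) ρ))
    (hf : ∀ ρ, IntegrableOn (fun x => f x * ‖x‖ ^ tauPlus N μ) (closedBall (0 : Euc N) ρ))
    (hζ : IsC11c ζ) (hζ0 : ζ 0 = 0) :
    ∫ x, u x * LstarMu N μ ζ x * ‖x‖ ^ tauPlus N μ =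
      ∫ x, f x * ζ x * ‖x‖ ^ tauPlus N μ := by
  have hum : AEStronglyMeasurable u volume :=
    aestronglyMeasurable_of_continuousOn_punctured hureg.continuousOn
  obtain ⟨ρ, C, hρ, hC, hin, hout⟩ := hζ.exists_bounds μ
  have ha : Tendsto (fun n : ℕ => 1 / ((n : ℝ) + 1)) atTop (nhds 0) :=
    tendsto_one_div_add_atTop_nhds_zero_nat
  have hY : 0 ≤ Real.log (ρ ^ 2) := Real.log_nonneg (one_le_pow₀ hρ)
  set M := 6 * (1 + Real.log (ρ ^ 2)) ^ 3
  have key : Tendsto (fun n : ℕ => ∫ x,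
      (testMain N μ u f ζ (cutoff (1 / ((n : ℝ) + 1))) (cutoffDeriv (1 / ((n : ℝ) + 1))) x +
        testBulk N μ u ζ (cutoffDeriv (1 / ((n : ℝ) + 1))) (cutoffDeriv₂ (1 / ((n : ℝ) + 1))) x))
      atTop (nhds (∫ x, (f x * ζ x * ‖x‖ ^ tauPlus N μ -
        u x * LstarMu N μ ζ x * ‖x‖ ^ tauPlus N μ))) := by
    refine tendsto_integral_of_dominated_convergence
      ((closedBall (0 : Euc N) ρ).indicator fun x =>
        M * C * (9 + 4 * √(mu0 N - μ)) * |u x * ‖x‖ ^ tauPlus N μ / ‖x‖| +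
          M * C * ρ * |f x * ‖x‖ ^ tauPlus N μ|) (fun n => ?_) ?_ (fun n => ?_) ?_
    · exact (aestronglyMeasurable_testMain hum hfm hζ (continuous_cutoff _)
        (continuous_cutoffDeriv _)).add (aestronglyMeasurable_testBulk hum hζ
          (continuous_cutoffDeriv _) (continuous_cutoffDeriv₂ _))
    · exact IntegrableOn.integrable_indicator (((hw ρ).abs.const_mul _).add
        ((hf ρ).abs.const_mul _)) measurableSet_closedBall
    · filter_upwards [Measure.ae_ne volume (0 : Euc N)] with x hx
      by_cases h : ρ < ‖x‖
      · obtain ⟨o1, o2, o3⟩ := hout x h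
        rw [Set.indicator_of_notMem (by simpa using h)]
        simp [testMain, testBulk, o1, o2, o3]
      rw [not_lt] at h
      rw [Set.indicator_of_mem (by simpa using h), Real.norm_eq_abs]
      have hn : 0 < ‖x‖ := norm_pos_iff.2 hx
      obtain ⟨i1, i2, i3⟩ := hin x hx
      rw [hζ0, sub_zero] at i3
      have hy : Real.log (‖x‖ ^ 2) ≤ Real.log (ρ ^ 2) := by gcongr
      obtain ⟨b1, b2, b3⟩ := cutoff_bounds (a := 1 / ((n : ℝ) + 1)) (by positivity)
        (by rw [div_le_one (by positivity)]; linarith [n.cast_nonneg (α := ℝ)]) hy hY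
      have p1 := cutoff_nonneg (1 / ((n : ℝ) + 1)) (Real.log (‖x‖ ^ 2))
      have p2 := cutoffDeriv_nonneg (a := 1 / ((n : ℝ) + 1)) (by positivity) (Real.log (‖x‖ ^ 2))
      have p3 := cutoffDeriv₂_nonneg (1 / ((n : ℝ) + 1)) (Real.log (‖x‖ ^ 2))
      rw [← abs_of_nonneg p1] at b1
      rw [← abs_of_nonneg p2] at b2
      rw [← abs_of_nonneg p3] at b3
      exact abs_testMain_add_testBulk_le hx h hC b1 b2 b3 i1 i2 i3
    · exact .of_forall fun x => by
        simpa only [add_zero] using (tendsto_testMain_cutoff ha x).add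
          (tendsto_testBulk_cutoff ha x)
  have hzero : ∀ n : ℕ, ∫ x,
      (testMain N μ u f ζ (cutoff (1 / ((n : ℝ) + 1))) (cutoffDeriv (1 / ((n : ℝ) + 1))) x +
        testBulk N μ u ζ (cutoffDeriv (1 / ((n : ℝ) + 1))) (cutoffDeriv₂ (1 / ((n : ℝ) + 1))) x) =
        0 := fun n =>
    (integral_testMain_add_testBulk hμ hureg hueq hζ (hasDerivAt_cutoff _)
      (hasDerivAt_cutoffDeriv _) (continuous_cutoffDeriv₂ _) fun s hs =>
        cutoff_eq_zero (by positivity) hs).2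
  simp only [hzero] at key
  have h := tendsto_nhds_unique key tendsto_const_nhds
  rw [integral_sub (integrable_mul_test hf hζ) (integrable_mul_LstarMu hum hw hζ)] at h
  linarith

lemma integral_mul_le_integral_mul_LstarMu {N : ℕ} [NeZero N] {μ : ℝ} (hμ : μ ≤ mu0 N)
    {u f χ : Euc N → ℝ} (hureg : ContDiffOn ℝ 2 u {x : Euc N | x ≠ 0})
    (hueq : ∀ x : Euc N, x ≠ 0 → -lap u x - μ * ‖x‖ ^ (-2 : ℝ) * u x = f x)
    (hfm : AEStronglyMeasurable f volume)
    (hχ : IsC11c χ) (hχ2 : ContDiff ℝ 2 χ) (hχ1 : χ =ᶠ[nhds 0] fun _ => 1)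
    (hχu : ∀ x, x ≠ 0 → 0 ≤ χ x * u x)
    (hout : ∀ x, 1 < ‖x‖ → χ x = 0 ∧ fderiv ℝ χ x x = 0 ∧ LstarMu N μ χ x = 0)
    (hw : ∀ ρ, IntegrableOn (fun x => u x * ‖x‖ ^ tauPlus N μ / ‖x‖) (closedBall (0 : Euc N) ρ))
    (hf : Integrable fun x => f x * χ x * ‖x‖ ^ tauPlus N μ) :
    ∫ x, f x * χ x * ‖x‖ ^ tauPlus N μ ≤
      ∫ x, u x * LstarMu N μ χ x * ‖x‖ ^ tauPlus N μ := by
  have hD := integrable_testMajorant hureg hχ hχ2 hχ1 hf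
  have hum : AEStronglyMeasurable u volume :=
    aestronglyMeasurable_of_continuousOn_punctured hureg.continuousOn
  have ha : Tendsto (fun n : ℕ => 1 / ((n : ℝ) + 1)) atTop (nhds 0) :=
    tendsto_one_div_add_atTop_nhds_zero_nat
  have ha0 : ∀ n : ℕ, 0 < 1 / ((n : ℝ) + 1) := fun n => by positivity
  have hm : ∀ n : ℕ, AEStronglyMeasurable (testMain N μ u f χ (cutoff (1 / ((n : ℝ) + 1)))
      (cutoffDeriv (1 / ((n : ℝ) + 1)))) volume := fun n =>
    aestronglyMeasurable_testMain hum hfm hχ (continuous_cutoff _) (continuous_cutoffDeriv _)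
  have hle : ∀ (n : ℕ) (x : Euc N), |testMain N μ u f χ (cutoff (1 / ((n : ℝ) + 1)))
      (cutoffDeriv (1 / ((n : ℝ) + 1))) x| ≤ 6 * testMajorant N μ u f χ x := by
    intro n x
    refine abs_testMain_le (fun hx => ?_) (hout x)
    obtain ⟨b1, b2, -⟩ := cutoff_bounds (ha0 n)
      (by rw [div_le_one (by positivity)]; linarith [n.cast_nonneg (α := ℝ)])
      (Real.log_nonpos (by positivity) (pow_le_one₀ (n := 2) (norm_nonneg x) hx)) le_rfl
    rw [abs_of_nonneg (cutoff_nonneg _ _), abs_of_nonneg (cutoffDeriv_nonneg (ha0 n) _)]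
    norm_num at b1 b2 ⊢
    exact ⟨b1, b2⟩
  have key := tendsto_integral_of_dominated_convergence (μ := volume)
    (fun x => 6 * testMajorant N μ u f χ x) hm (hD.const_mul 6) (fun n => .of_forall (hle n))
    (.of_forall (tendsto_testMain_cutoff ha))
  have hnonpos : ∀ n : ℕ, ∫ x, testMain N μ u f χ (cutoff (1 / ((n : ℝ) + 1)))
      (cutoffDeriv (1 / ((n : ℝ) + 1))) x ≤ 0 := by
    intro n
    obtain ⟨j1, j2⟩ := integral_testMain_add_testBulk hμ hureg hueq hχ
      (hasDerivAt_cutoff (1 / ((n : ℝ) + 1))) (hasDerivAt_cutoffDeriv _) (continuous_cutoffDeriv₂ _)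
      fun s hs => cutoff_eq_zero (ha0 n) hs
    have iA := (hD.const_mul 6).mono' (hm n) (.of_forall (hle n))
    have iB : Integrable (testBulk N μ u χ (cutoffDeriv (1 / ((n : ℝ) + 1)))
        (cutoffDeriv₂ (1 / ((n : ℝ) + 1)))) :=
      (j1.sub iA).congr (.of_forall fun x => by simp)
    have hB : 0 ≤ ∫ x, testBulk N μ u χ (cutoffDeriv (1 / ((n : ℝ) + 1)))
        (cutoffDeriv₂ (1 / ((n : ℝ) + 1))) x := by
      refine integral_nonneg_of_ae ?_
      filter_upwards [Measure.ae_ne volume (0 : Euc N)] with x hx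
      have p2 := cutoffDeriv_nonneg (ha0 n) (Real.log (‖x‖ ^ 2))
      have p3 := cutoffDeriv₂_nonneg (1 / ((n : ℝ) + 1)) (Real.log (‖x‖ ^ 2))
      rw [testBulk, mul_assoc (u x), mul_div_assoc, ← mul_assoc]
      exact mul_nonneg (hχu x hx) (by positivity)
    rw [integral_add iA iB] at j2
    linarith
  have h := le_of_tendsto' key hnonpos
  rw [integral_sub hf (integrable_mul_LstarMu hum hw hχ)] at h
  linarith

lemma cMu_pos {N : ℕ} [NeZero N] {μ : ℝ} : 0 < cMu N μ := by
  have hs : 0 < sphereArea N := by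
    refine mul_pos (by exact_mod_cast NeZero.pos N) (ENNReal.toReal_pos ?_ ?_)
    · exact (measure_ball_pos _ _ one_pos).ne'
    · exact measure_ball_lt_top.ne
  rw [cMu]
  split_ifs with h
  · have := Real.sqrt_pos.2 (sub_pos.2 h)
    positivity
  · exact hs

/-- Lemma 2.4: a positive singular solution of L_μ u = f satisfies the
dμ-distributional identity for some k ≥ 0. -/
theorem singular_solution_identity_hardy
    (N : ℕ) (hN : 2 ≤ N) (μ : ℝ) (hμ : μ ≤ mu0 N)
    (γ : ℝ) (hγ : 0 < γ ∧ γ < 1) (f : Euc N → ℝ)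
    (hfreg : LocHolderOn γ {x : Euc N | x ≠ 0} f)
    (hfint : ∀ K : Set (Euc N), IsCompact K →
      ∫⁻ x in K, ENNReal.ofReal (|f x| * ‖x‖ ^ tauPlus N μ) < ⊤)
    (u : Euc N → ℝ)
    (hureg : ContDiffOn ℝ 2 u {x : Euc N | x ≠ 0})
    (hueq : ∀ x : Euc N, x ≠ 0 → -lap u x - μ * ‖x‖ ^ (-2 : ℝ) * u x = f x)
    (huinf : Tendsto u (normAtTop N) (nhds 0))
    (r : ℝ) (hr : 0 < r) (hunn : ∀ x : Euc N, x ≠ 0 → ‖x‖ < r → 0 ≤ u x) :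
    ∃ k : ℝ, 0 ≤ k ∧ ∀ ξ : Euc N → ℝ, IsC11c ξ →
      ∫ x : Euc N, u x * LstarMu N μ ξ x * ‖x‖ ^ tauPlus N μ =
        (∫ x : Euc N, f x * ξ x * ‖x‖ ^ tauPlus N μ) + cMu N μ * k * ξ 0 := by
  have : NeZero N := ⟨by omega⟩
  have hum : AEStronglyMeasurable u volume :=
    aestronglyMeasurable_of_continuousOn_punctured hureg.continuousOn
  have hfm : AEStronglyMeasurable f volume := by
    refine aestronglyMeasurable_of_continuousOn_punctured (ContinuousOn.congr
      ((continuousOn_lap hureg).neg.sub ((continuousOn_const.mul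
        (continuousOn_rpow_norm (-2))).mul hureg.continuousOn)) fun x hx => (hueq x hx).symm)
  have hPm : Measurable fun x : Euc N => ‖x‖ ^ tauPlus N μ := by fun_prop
  have hf : ∀ ρ, IntegrableOn (fun x => f x * ‖x‖ ^ tauPlus N μ) (closedBall (0 : Euc N) ρ) := by
    refine fun ρ => ⟨(hfm.mul hPm.aestronglyMeasurable).restrict, ?_⟩
    rw [hasFiniteIntegral_iff_norm]
    refine lt_of_eq_of_lt ?_ (hfint _ (isCompact_closedBall 0 ρ))
    congr 1 with x
    rw [norm_mul, Real.norm_eq_abs, Real.norm_of_nonneg (by positivity)]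
  obtain ⟨χ, hχ2, hχc, hχ1, hχu, hout⟩ : ∃ χ : Euc N → ℝ, ContDiff ℝ 2 χ ∧ HasCompactSupport χ ∧
      (χ =ᶠ[nhds 0] fun _ => 1) ∧ (∀ x, x ≠ 0 → 0 ≤ χ x * u x) ∧
      ∀ x, 1 < ‖x‖ → χ x = 0 ∧ fderiv ℝ χ x x = 0 ∧ LstarMu N μ χ x = 0 := by
    have hr0 : 0 < min r 1 := lt_min hr one_pos
    let b : ContDiffBump (0 : Euc N) := ⟨min r 1 / 2, min r 1, by linarith, by linarith⟩
    have hz : ∀ x : Euc N, min r 1 ≤ ‖x‖ → b x = 0 := fun x hx =>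
      b.zero_of_le_dist (by rwa [dist_zero_right])
    refine ⟨b, b.contDiff, b.hasCompactSupport, b.eventuallyEq_one, fun x hx => ?_, fun x hx => ?_⟩
    · rcases lt_or_ge ‖x‖ (min r 1) with h | h
      · exact mul_nonneg b.nonneg (hunn x hx (h.trans_le (min_le_left _ _)))
      · simp [hz x h]
    · have he : (b : Euc N → ℝ) =ᶠ[nhds x] fun _ => 0 := by
        filter_upwards [continuous_norm.continuousAt.eventually (lt_mem_nhds hx)] with y hy
        exact hz y ((min_le_right _ _).trans hy.le)
      obtain ⟨h1, h2⟩ := LstarMu_eq_zero_of_eventuallyEq_const (μ := μ) he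
      exact ⟨he.self_of_nhds, by simp [h2], h1⟩
  have hχ : IsC11c χ := isC11c_of_contDiff hχc hχ2
  have hfχ := integrable_mul_test hf hχ
  have hw := integrableOn_mul_weight_div_norm hureg hχ1
    (integrable_mul_weight_div_norm hμ hureg hueq hfm hχ hχ2 hχ1 hχu hout hfχ)
  have hK := integral_mul_le_integral_mul_LstarMu hμ hureg hueq hfm hχ hχ2 hχ1 hχu hout hw hfχ
  have hcμ : 0 < cMu N μ := cMu_pos
  refine ⟨((∫ x, u x * LstarMu N μ χ x * ‖x‖ ^ tauPlus N μ) -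
    ∫ x, f x * χ x * ‖x‖ ^ tauPlus N μ) / cMu N μ, div_nonneg (sub_nonneg.2 hK) hcμ.le,
    fun ξ hξ => ?_⟩
  have h := integral_mul_LstarMu_eq_of_apply_zero hμ hureg hueq hfm hw hf
    (hξ.sub_const_mul hχ (ξ 0)) (by simp [hχ1.self_of_nhds])
  have h1 : ∫ x, u x * LstarMu N μ (fun x => ξ x - ξ 0 * χ x) x * ‖x‖ ^ tauPlus N μ =
      (∫ x, u x * LstarMu N μ ξ x * ‖x‖ ^ tauPlus N μ) -
        ξ 0 * ∫ x, u x * LstarMu N μ χ x * ‖x‖ ^ tauPlus N μ := by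
    rw [← integral_const_mul, ← integral_sub (integrable_mul_LstarMu hum hw hξ)
      ((integrable_mul_LstarMu hum hw hχ).const_mul _)]
    refine integral_congr_ae ?_
    filter_upwards [hξ.LstarMu_sub_const_mul (μ := μ) hχ (ξ 0)] with x hx
    rw [hx]
    ring
  have h2 : ∫ x, f x * (ξ x - ξ 0 * χ x) * ‖x‖ ^ tauPlus N μ =
      (∫ x, f x * ξ x * ‖x‖ ^ tauPlus N μ) - ξ 0 * ∫ x, f x * χ x * ‖x‖ ^ tauPlus N μ := by
    rw [← integral_const_mul, ← integral_sub (integrable_mul_test hf hξ) (hfχ.const_mul _)]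
    congr 1 with x
    ring
  rw [h1, h2] at h
  rw [mul_div_cancel₀ _ hcμ.ne']
  linarith
end
end

section
/- Let N ≥ 3, 0 < μ < μ₀ = (N-2)²/4, and let e ∈ ℝ^N with |e| = 1. Then μ c_N ∫_{ℝ^N} |y|^{τ₋(μ)-2} |e - y|^{2-N} dy = 1, where c_N = ((N-2)|𝕊^{N-1}|)^{-1}; equivalently, ∫_{ℝ^N} |y|^{τ₋(μ)-2} |e - y|^{2-N} dy = (N-2)|𝕊^{N-1}|/μ. -/
open Filter MeasureTheory Metric

noncomputable section

/-- The Gamma integral after the substitution `t ↦ b / t`. -/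
theorem lintegral_rpow_mul_exp_neg_div {k b : ℝ} (hk : 0 < k) (hb : 0 < b) :
    ∫⁻ t in Set.Ioi (0 : ℝ), ENNReal.ofReal (t ^ (-k - 1) * Real.exp (-(b / t)))
      = ENNReal.ofReal (Real.Gamma k * b ^ (-k)) := by
  have hint : IntegrableOn (fun t : ℝ => t ^ (k - 1) * Real.exp (-b * t)) (Set.Ioi 0) := by
    simpa using integrableOn_rpow_mul_exp_neg_mul_rpow (p := 1) (s := k - 1) (b := b)
      (by linarith) one_pos hb
  have hval : ∫ t in Set.Ioi (0 : ℝ), t ^ (k - 1) * Real.exp (-b * t)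
      = Real.Gamma k * b ^ (-k) := by
    have h := Real.integral_rpow_mul_exp_neg_mul_Ioi hk hb
    simp only [neg_mul] at h ⊢
    rw [h, one_div, Real.inv_rpow hb.le, Real.rpow_neg hb.le, mul_comm]
  have hcongr : Set.EqOn
      (fun t : ℝ => (|(-1 : ℝ)| * t ^ ((-1 : ℝ) - 1)) •
        ((t ^ (-1 : ℝ)) ^ (k - 1) * Real.exp (-b * t ^ (-1 : ℝ))))
      (fun t => t ^ (-k - 1) * Real.exp (-(b / t))) (Set.Ioi 0) := by
    intro t ht
    have ht' : (0 : ℝ) < t := ht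
    simp only [smul_eq_mul, abs_neg, abs_one, one_mul]
    rw [← Real.rpow_mul ht'.le, ← mul_assoc, ← Real.rpow_add ht', Real.rpow_neg_one]
    congr 2 <;> ring
  have hint' := (integrableOn_Ioi_comp_rpow_iff _ (by norm_num : (-1 : ℝ) ≠ 0)).mpr hint
  have hval' := integral_comp_rpow_Ioi (fun t : ℝ => t ^ (k - 1) * Real.exp (-b * t))
    (by norm_num : (-1 : ℝ) ≠ 0)
  rw [integrableOn_congr_fun hcongr measurableSet_Ioi] at hint'
  rw [setIntegral_congr_fun measurableSet_Ioi hcongr, hval] at hval'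
  rw [← hval', ofReal_integral_eq_lintegral_ofReal hint']
  filter_upwards [ae_restrict_mem measurableSet_Ioi] with t ht
  have ht' : (0 : ℝ) < t := ht
  simp only [Pi.zero_apply]
  positivity

/-- The convolution of two Gaussians. -/
theorem lintegral_exp_mul_exp_norm_sub {N : ℕ} (e : Euc N) {t s : ℝ} (ht : 0 < t) (hs : 0 < s) :
    ∫⁻ y : Euc N, ENNReal.ofReal (Real.exp (-(‖y‖ ^ 2 / t)) * Real.exp (-(‖e - y‖ ^ 2 / s)))
      = ENNReal.ofReal ((Real.pi * (t * s / (t + s))) ^ ((N : ℝ) / 2) *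
          Real.exp (-(‖e‖ ^ 2 / (t + s)))) := by
  have hb : 0 < (t + s) / (t * s) := by positivity
  have hpi := GaussianFourier.integral_rexp_neg_mul_sq_norm (V := Euc N) hb
  rw [finrank_euclideanSpace_fin] at hpi
  have hint : Integrable (fun y : Euc N => Real.exp (-((t + s) / (t * s)) * ‖y‖ ^ 2)) := by
    refine Integrable.of_integral_ne_zero ?_
    rw [hpi]
    positivity
  have hsq : ∀ y : Euc N, Real.exp (-(‖y‖ ^ 2 / t)) * Real.exp (-(‖e - y‖ ^ 2 / s))
      = Real.exp (-((t + s) / (t * s)) * ‖y - (t / (t + s)) • e‖ ^ 2) *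
        Real.exp (-(‖e‖ ^ 2 / (t + s))) := by
    intro y
    rw [← Real.exp_add, ← Real.exp_add, norm_sub_sq_real, norm_sub_sq_real, norm_smul,
      inner_smul_right, real_inner_comm, mul_pow, Real.norm_eq_abs, sq_abs]
    congr 1
    field_simp
    ring
  simp_rw [hsq, ENNReal.ofReal_mul (Real.exp_pos _).le]
  rw [lintegral_mul_const' _ _ ENNReal.ofReal_ne_top,
    lintegral_sub_right_eq_self
      (fun y : Euc N => ENNReal.ofReal (Real.exp (-((t + s) / (t * s)) * ‖y‖ ^ 2))),
    ← ofReal_integral_eq_lintegral_ofReal hint (Eventually.of_forall fun _ => (Real.exp_pos _).le),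
    hpi, ← ENNReal.ofReal_mul (by positivity)]
  congr 3
  field_simp

theorem setLIntegral_Ioi_comp_add_left (f : ℝ → ENNReal) (t : ℝ) :
    ∫⁻ s in Set.Ioi 0, f (t + s) = ∫⁻ r in Set.Ioi t, f r := by
  have h := (measurePreserving_add_left volume t).setLIntegral_comp_preimage_emb
    (measurableEmbedding_addLeft t) f (Set.Ioi t)
  simpa using h

theorem setLIntegral_Ioi_Ioi_swap {h : ℝ → ℝ → ENNReal} (hh : Measurable (Function.uncurry h)) :
    ∫⁻ t in Set.Ioi 0, ∫⁻ r in Set.Ioi t, h t r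
      = ∫⁻ r in Set.Ioi 0, ∫⁻ t in Set.Ioo 0 r, h t r := by
  have hS : MeasurableSet {q : ℝ × ℝ | 0 < q.1 ∧ q.1 < q.2} :=
    (measurableSet_lt measurable_const measurable_fst).inter
      (measurableSet_lt measurable_fst measurable_snd)
  have key := lintegral_lintegral_swap (μ := (volume : Measure ℝ)) (ν := (volume : Measure ℝ))
    (f := fun t r => {q : ℝ × ℝ | 0 < q.1 ∧ q.1 < q.2}.indicator (Function.uncurry h) (t, r))
    (hh.indicator hS).aemeasurable
  calc
    _ = ∫⁻ t, ∫⁻ r, {q : ℝ × ℝ | 0 < q.1 ∧ q.1 < q.2}.indicator (Function.uncurry h) (t, r) := by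
      rw [← lintegral_indicator measurableSet_Ioi]
      refine lintegral_congr fun t => ?_
      by_cases ht : 0 < t
      · rw [Set.indicator_of_mem (by exact ht), ← lintegral_indicator measurableSet_Ioi]
        refine lintegral_congr fun r => ?_
        simp [Set.indicator_apply, ht]
      · simp [ht]
    _ = _ := key
    _ = _ := by
      rw [← lintegral_indicator measurableSet_Ioi]
      refine lintegral_congr fun r => ?_
      by_cases hr : 0 < r
      · rw [Set.indicator_of_mem (by exact hr), ← lintegral_indicator measurableSet_Ioo]
        refine lintegral_congr fun t => ?_
        simp [Set.indicator_apply]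
      · have : ∀ t, ¬ (0 < t ∧ t < r) := fun t ht => hr (ht.1.trans ht.2)
        simp [hr, this]

theorem setLIntegral_Ioo_rpow {α r : ℝ} (hα : 0 < α) (hr : 0 < r) :
    ∫⁻ t in Set.Ioo 0 r, ENNReal.ofReal (t ^ (α - 1)) = ENNReal.ofReal (r ^ α / α) := by
  have hint : IntegrableOn (fun t : ℝ => t ^ (α - 1)) (Set.Ioo 0 r) := by
    have := (intervalIntegral.intervalIntegrable_rpow' (a := 0) (b := r) (r := α - 1)
      (by linarith)).1
    exact this.mono_set Set.Ioo_subset_Ioc_self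
  have hval : ∫ t in Set.Ioo 0 r, t ^ (α - 1) = r ^ α / α := by
    rw [← integral_Ioc_eq_integral_Ioo, ← intervalIntegral.integral_of_le hr.le,
      integral_rpow (Or.inl (by linarith))]
    simp [hα.ne']
  rw [← hval, ofReal_integral_eq_lintegral_ofReal hint]
  filter_upwards [ae_restrict_mem measurableSet_Ioo] with t ht
  exact Real.rpow_nonneg ht.1.le _

/-- The time integral left over after convolving two superpositions of heat kernels. -/
theorem lintegral_lintegral_rpow_mul_exp_add {α k : ℝ} (hα : 0 < α) (hk : 0 < k - α - 1) :
    ∫⁻ t in Set.Ioi (0 : ℝ), ∫⁻ s in Set.Ioi (0 : ℝ),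
        ENNReal.ofReal (t ^ (α - 1) * ((t + s) ^ (-k) * Real.exp (-(1 / (t + s)))))
      = ENNReal.ofReal (Real.Gamma (k - α - 1) / α) := by
  calc
    _ = ∫⁻ t in Set.Ioi (0 : ℝ), ∫⁻ r in Set.Ioi t,
        ENNReal.ofReal (t ^ (α - 1) * (r ^ (-k) * Real.exp (-(1 / r)))) :=
      lintegral_congr fun t => setLIntegral_Ioi_comp_add_left
        (fun r => ENNReal.ofReal (t ^ (α - 1) * (r ^ (-k) * Real.exp (-(1 / r))))) t
    _ = ∫⁻ r in Set.Ioi (0 : ℝ), ∫⁻ t in Set.Ioo 0 r,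
        ENNReal.ofReal (t ^ (α - 1) * (r ^ (-k) * Real.exp (-(1 / r)))) :=
      setLIntegral_Ioi_Ioi_swap (by unfold Function.uncurry; fun_prop)
    _ = ∫⁻ r in Set.Ioi (0 : ℝ), ENNReal.ofReal (1 / α) *
        ENNReal.ofReal (r ^ (-(k - α - 1) - 1) * Real.exp (-(1 / r))) := by
      refine setLIntegral_congr_fun measurableSet_Ioi fun r hr => ?_
      have hr' : (0 : ℝ) < r := hr
      have hnn : 0 ≤ r ^ (-k) * Real.exp (-(1 / r)) := by positivity
      simp only [ENNReal.ofReal_mul' hnn]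
      rw [lintegral_mul_const' _ _ ENNReal.ofReal_ne_top, setLIntegral_Ioo_rpow hα hr',
        ← ENNReal.ofReal_mul (by positivity), ← ENNReal.ofReal_mul (by positivity)]
      congr 1
      rw [show -(k - α - 1) - 1 = α + -k by ring, Real.rpow_add hr']
      ring
    _ = _ := by
      rw [lintegral_const_mul' _ _ ENNReal.ofReal_ne_top,
        lintegral_rpow_mul_exp_neg_div hk one_pos, ← ENNReal.ofReal_mul (by positivity)]
      congr 1
      simp
      ring

theorem lintegral_rpow_mul_exp_neg_norm_sq_div {N : ℕ} {p : ℝ} (hp : 0 < p) {y : Euc N}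
    (hy : y ≠ 0) :
    ∫⁻ t in Set.Ioi (0 : ℝ), ENNReal.ofReal (t ^ (-p - 1) * Real.exp (-(‖y‖ ^ 2 / t)))
      = ENNReal.ofReal (Real.Gamma p * ‖y‖ ^ (-(2 * p))) := by
  have hy' : 0 < ‖y‖ := norm_pos_iff.mpr hy
  rw [lintegral_rpow_mul_exp_neg_div hp (by positivity), ← Real.rpow_natCast, ← Real.rpow_mul hy'.le]
  congr 3
  push_cast
  ring

/-- Composition of the Riesz kernels `|y|^(-2p)` and `|y|^(2-N)`, at a point of the unit sphere. -/
theorem lintegral_norm_rpow_mul_norm_sub_rpow {N : ℕ} (hN : 3 ≤ N) {p : ℝ} (hp : 1 < p)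
    (hpN : p < (N : ℝ) / 2) {e : Euc N} (he : ‖e‖ = 1) :
    ENNReal.ofReal (Real.Gamma p * Real.Gamma ((N : ℝ) / 2 - 1)) *
      ∫⁻ y : Euc N, ENNReal.ofReal (‖y‖ ^ (-(2 * p)) * ‖e - y‖ ^ ((2 : ℝ) - N))
      = ENNReal.ofReal (Real.pi ^ ((N : ℝ) / 2) * (Real.Gamma (p - 1) / ((N : ℝ) / 2 - p))) := by
  have hN' : (3 : ℝ) ≤ N := by exact_mod_cast hN
  have : Nonempty (Fin N) := ⟨⟨0, by omega⟩⟩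
  have hq : 0 < (N : ℝ) / 2 - 1 := by linarith
  have hΓp : 0 < Real.Gamma p := Real.Gamma_pos_of_pos (by linarith)
  have hΓq : 0 < Real.Gamma ((N : ℝ) / 2 - 1) := Real.Gamma_pos_of_pos hq
  have hne0 : ∀ᵐ y : Euc N, y ≠ 0 := Measure.ae_ne volume 0
  have hnee : ∀ᵐ y : Euc N, y ≠ e := Measure.ae_ne volume e
  calc
    _ = ∫⁻ y : Euc N, ∫⁻ t in Set.Ioi (0 : ℝ),
        ENNReal.ofReal (t ^ (-p - 1) * Real.exp (-(‖y‖ ^ 2 / t))) *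
        ENNReal.ofReal (Real.Gamma ((N : ℝ) / 2 - 1) * ‖e - y‖ ^ ((2 : ℝ) - N)) := by
      rw [← lintegral_const_mul' _ _ ENNReal.ofReal_ne_top]
      refine lintegral_congr_ae ?_
      filter_upwards [hne0] with y hy
      rw [lintegral_mul_const' _ _ ENNReal.ofReal_ne_top,
        lintegral_rpow_mul_exp_neg_norm_sq_div (by linarith) hy,
        ← ENNReal.ofReal_mul (by positivity), ← ENNReal.ofReal_mul (by positivity)]
      congr 1
      ring
    _ = ∫⁻ t in Set.Ioi (0 : ℝ), ∫⁻ y : Euc N,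
        ENNReal.ofReal (t ^ (-p - 1) * Real.exp (-(‖y‖ ^ 2 / t))) *
        ENNReal.ofReal (Real.Gamma ((N : ℝ) / 2 - 1) * ‖e - y‖ ^ ((2 : ℝ) - N)) := by
      refine lintegral_lintegral_swap (Measurable.aemeasurable ?_)
      unfold Function.uncurry
      fun_prop
    _ = ∫⁻ t in Set.Ioi (0 : ℝ), ∫⁻ y : Euc N, ∫⁻ s in Set.Ioi (0 : ℝ),
        ENNReal.ofReal (t ^ (-p - 1) * Real.exp (-(‖y‖ ^ 2 / t))) *
        ENNReal.ofReal (s ^ (-((N : ℝ) / 2 - 1) - 1) * Real.exp (-(‖e - y‖ ^ 2 / s))) := by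
      refine lintegral_congr fun t => lintegral_congr_ae ?_
      filter_upwards [hnee] with y hy
      rw [lintegral_const_mul' _ _ ENNReal.ofReal_ne_top,
        lintegral_rpow_mul_exp_neg_norm_sq_div hq (sub_ne_zero.mpr hy.symm)]
      congr 4
      ring
    _ = ∫⁻ t in Set.Ioi (0 : ℝ), ∫⁻ s in Set.Ioi (0 : ℝ), ∫⁻ y : Euc N,
        ENNReal.ofReal (t ^ (-p - 1) * Real.exp (-(‖y‖ ^ 2 / t))) *
        ENNReal.ofReal (s ^ (-((N : ℝ) / 2 - 1) - 1) * Real.exp (-(‖e - y‖ ^ 2 / s))) := by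
      refine lintegral_congr fun t => lintegral_lintegral_swap (Measurable.aemeasurable ?_)
      unfold Function.uncurry
      fun_prop
    _ = ∫⁻ t in Set.Ioi (0 : ℝ), ∫⁻ s in Set.Ioi (0 : ℝ),
        ENNReal.ofReal (Real.pi ^ ((N : ℝ) / 2)) *
        ENNReal.ofReal (t ^ (((N : ℝ) / 2 - p) - 1) *
          ((t + s) ^ (-((N : ℝ) / 2)) * Real.exp (-(1 / (t + s))))) := by
      refine setLIntegral_congr_fun measurableSet_Ioi fun t ht =>
        setLIntegral_congr_fun measurableSet_Ioi fun s hs => ?_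
      have ht' : (0 : ℝ) < t := ht
      have hs' : (0 : ℝ) < s := hs
      have hfac : ∀ y : Euc N,
          ENNReal.ofReal (t ^ (-p - 1) * Real.exp (-(‖y‖ ^ 2 / t))) *
            ENNReal.ofReal (s ^ (-((N : ℝ) / 2 - 1) - 1) * Real.exp (-(‖e - y‖ ^ 2 / s)))
          = ENNReal.ofReal (t ^ (-p - 1) * s ^ (-((N : ℝ) / 2 - 1) - 1)) *
            ENNReal.ofReal (Real.exp (-(‖y‖ ^ 2 / t)) * Real.exp (-(‖e - y‖ ^ 2 / s))) := by
        intro y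
        rw [← ENNReal.ofReal_mul (by positivity), ← ENNReal.ofReal_mul (by positivity)]
        congr 1
        ring
      simp only [hfac]
      rw [lintegral_const_mul' _ _ ENNReal.ofReal_ne_top,
        lintegral_exp_mul_exp_norm_sub e ht' hs', ← ENNReal.ofReal_mul (by positivity),
        ← ENNReal.ofReal_mul (by positivity), he]
      congr 1
      rw [Real.mul_rpow Real.pi_nonneg (by positivity), Real.div_rpow (by positivity) (by positivity),
        Real.mul_rpow ht'.le hs'.le, Real.rpow_neg (by positivity : (0 : ℝ) ≤ t + s),
        show -((N : ℝ) / 2 - 1) - 1 = -((N : ℝ) / 2) by ring, Real.rpow_neg hs'.le,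
        show (N : ℝ) / 2 - p - 1 = (-p - 1) + (N : ℝ) / 2 by ring, Real.rpow_add ht']
      have : 0 < s ^ ((N : ℝ) / 2) := by positivity
      field_simp
    _ = _ := by
      have h := lintegral_lintegral_rpow_mul_exp_add (α := (N : ℝ) / 2 - p) (k := (N : ℝ) / 2)
        (by linarith) (by linarith)
      simp only [lintegral_const_mul' _ _ ENNReal.ofReal_ne_top]
      rw [h, ← ENNReal.ofReal_mul (by positivity)]
      congr 4
      ring

theorem integral_norm_rpow_mul_norm_sub_rpow {N : ℕ} (hN : 3 ≤ N) {p : ℝ} (hp : 1 < p)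
    (hpN : p < (N : ℝ) / 2) {e : Euc N} (he : ‖e‖ = 1) :
    ∫ y : Euc N, ‖y‖ ^ (-(2 * p)) * ‖e - y‖ ^ ((2 : ℝ) - N)
      = Real.pi ^ ((N : ℝ) / 2) /
        ((p - 1) * ((N : ℝ) / 2 - p) * Real.Gamma ((N : ℝ) / 2 - 1)) := by
  have hN' : (3 : ℝ) ≤ N := by exact_mod_cast hN
  have hΓ1 : 0 < Real.Gamma (p - 1) := Real.Gamma_pos_of_pos (by linarith)
  have hΓq : 0 < Real.Gamma ((N : ℝ) / 2 - 1) := Real.Gamma_pos_of_pos (by linarith)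
  have hp1 : 0 < p - 1 := by linarith
  have hα : 0 < (N : ℝ) / 2 - p := by linarith
  have hΓp : Real.Gamma p = (p - 1) * Real.Gamma (p - 1) := by
    rw [← Real.Gamma_add_one hp1.ne', sub_add_cancel]
  have key := congrArg ENNReal.toReal (lintegral_norm_rpow_mul_norm_sub_rpow hN hp hpN he)
  rw [ENNReal.toReal_mul, hΓp, ENNReal.toReal_ofReal (by positivity),
    ENNReal.toReal_ofReal (by positivity)] at key
  rw [integral_eq_lintegral_of_nonneg_ae (Eventually.of_forall fun y => by
      simp only [Pi.zero_apply]; positivity)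
    (Measurable.aestronglyMeasurable (by fun_prop)), eq_div_iff (by positivity)]
  generalize (∫⁻ y : Euc N, ENNReal.ofReal (‖y‖ ^ (-(2 * p)) * ‖e - y‖ ^ ((2 : ℝ) - N))).toReal = I
    at key ⊢
  generalize Real.Gamma ((N : ℝ) / 2 - 1) = G at key ⊢
  generalize Real.pi ^ ((N : ℝ) / 2) = P at key ⊢
  generalize (N : ℝ) / 2 - p = α at key hα ⊢
  field_simp at key
  linarith

theorem sub_two_mul_sphereArea {N : ℕ} (hN : 3 ≤ N) :
    ((N : ℝ) - 2) * sphereArea N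
      = 4 * Real.pi ^ ((N : ℝ) / 2) / Real.Gamma ((N : ℝ) / 2 - 1) := by
  have hN' : (3 : ℝ) ≤ N := by exact_mod_cast hN
  have : Nonempty (Fin N) := ⟨⟨0, by omega⟩⟩
  have hq : 0 < (N : ℝ) / 2 - 1 := by linarith
  have hΓq : 0 < Real.Gamma ((N : ℝ) / 2 - 1) := Real.Gamma_pos_of_pos hq
  have hΓ : Real.Gamma ((N : ℝ) / 2 + 1)
      = (N : ℝ) / 2 * (((N : ℝ) / 2 - 1) * Real.Gamma ((N : ℝ) / 2 - 1)) := by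
    rw [Real.Gamma_add_one (by positivity), ← Real.Gamma_add_one hq.ne', sub_add_cancel]
  have hsqrt : Real.sqrt Real.pi ^ N = Real.pi ^ ((N : ℝ) / 2) := by
    rw [Real.sqrt_eq_rpow, ← Real.rpow_natCast, ← Real.rpow_mul Real.pi_nonneg]
    congr 1
    ring
  have hN2 : (N : ℝ) - 2 ≠ 0 := by linarith
  rw [sphereArea, EuclideanSpace.volume_ball, Fintype.card_fin, hΓ, hsqrt]
  simp only [ENNReal.ofReal_one, one_pow, one_mul]
  rw [ENNReal.toReal_ofReal (by positivity)]
  have h2 : (N : ℝ) / 2 - 1 = (N - 2) / 2 := by ring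
  have hN0 : (N : ℝ) ≠ 0 := by linarith
  field_simp
  ring

/-- Lemma 3.3 (identity (2.2)): the normalized Newtonian potential of μ|y|^{τ₋(μ)-2}
equals 1 on the unit sphere. -/
theorem newtonian_potential_identity_on_sphere
    (N : ℕ) (hN : 3 ≤ N) (μ : ℝ) (hμ : 0 < μ) (hμ0 : μ < mu0 N)
    (e : Euc N) (he : ‖e‖ = 1) :
    μ * cN N * ∫ y : Euc N, ‖y‖ ^ (tauMinus N μ - 2) * ‖e - y‖ ^ ((2 : ℝ) - N) = 1 := by
  have hN' : (3 : ℝ) ≤ N := by exact_mod_cast hN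
  obtain ⟨σ, hσ⟩ : ∃ σ, σ = Real.sqrt (mu0 N - μ) := ⟨_, rfl⟩
  have hσ0 : 0 < σ := hσ ▸ Real.sqrt_pos.mpr (by linarith)
  have hσsq : σ ^ 2 = ((N : ℝ) - 2) ^ 2 / 4 - μ := by
    rw [hσ, Real.sq_sqrt (by linarith), mu0]
  have hσN : σ < ((N : ℝ) - 2) / 2 := by nlinarith
  have hexp : tauMinus N μ - 2 = -(2 * ((N : ℝ) / 4 + 1 / 2 + σ / 2)) := by
    rw [tauMinus, ← hσ]
    ring
  have hΓq : 0 < Real.Gamma ((N : ℝ) / 2 - 1) := Real.Gamma_pos_of_pos (by linarith)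
  have hpi : 0 < Real.pi ^ ((N : ℝ) / 2) := by positivity
  rw [hexp, integral_norm_rpow_mul_norm_sub_rpow hN (by linarith) (by linarith) he, cN,
    sub_two_mul_sphereArea hN,
    show ((N : ℝ) / 4 + 1 / 2 + σ / 2 - 1) * ((N : ℝ) / 2 - ((N : ℝ) / 4 + 1 / 2 + σ / 2)) = μ / 4 by
      linear_combination (-1 / 4) * hσsq]
  generalize Real.Gamma ((N : ℝ) / 2 - 1) = G at hΓq ⊢
  field_simp
end
end
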